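/- Let $(M,g)$ be a smooth four-dimensional Lorentzian spacetime (signature $(+,-,-,-)$, not necessarily Einstein) with a smooth spin dyad $(o^A,\iota^A)$, $o_A\iota^A=1$, and null tetrad $l^a=o^A\bar o^{A'}$, $n^a=\iota^A\bar\iota^{A'}$, $m^a=o^A\bar\iota^{A'}$, $\bar m^a=\iota^A\bar o^{A'}$. Let $\nabla_{AA'}$ be the spinor Levi-Civita connection, $D=l^a\nabla_a$, $D'=n^a\nabla_a$, $\delta=m^a\nabla_a$, $\delta'=\bar m^a\nabla_a$, and let $\rho=o^A\delta' o_A$, $\tau=o^AD'o_A$, $\rho'=-\iota^A\delta\iota_A$, $\tau'=-\iota^AD\iota_A$, $\varepsilon=\iota^ADo_A$, $\beta=\iota^A\delta o_A$, $\varepsilon'=-o^AD'\iota_A$, $\beta'=-o^A\delta'\iota_A$ be GHP spin coefficients. On scalars of GHP weight $\{p,0\}$ the GHP operators are $$\text{þ}=D-p\varepsilon,\qquad \text{ð}=\delta-p\beta,\qquad \text{þ}'=D'+p\varepsilon',\qquad \text{ð}'=\delta'+p\beta',$$ and on scalars of GHP weight $\{p,0\}$ and conformal weight $w$ the conformal-GHP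 connection is $$\mathcal C_{AA'}\psi=\nabla_{AA'}\psi+\bigl(w f_{AA'}+p(\omega_{AA'}+B_{AA'})\bigr)\psi,$$ where $\omega_a=-\varepsilon n_a+\varepsilon' l_a-\beta' m_a+\beta\bar m_a$, $B_a=-\rho n_a+\tau\bar m_a$, $f_a=\rho n_a+\rho' l_a-\tau' m_a-\tau\bar m_a$. Put $\tilde{\mathcal C}_{A'}=o^A\mathcal C_{AA'}$ and $\mathcal C_{A'}=\iota^A\mathcal C_{AA'}$. Suppose that $o^A$ is a shear-free ray, $o^Ao^B\nabla_{AA'}o_B=0$, and a repeated principal spinor of the Weyl spinor, $\Psi_{ABCD}o^Bo^Co^D=0$, and that $\Psi_2=\Psi_{ABCD}o^Ao^B\iota^C\iota^D$ vanishes nowhere (Petrov type D or II). Let $K_0,K_1,K_2$ be smooth complex scalar fields, and let $$K_{AB}=K_2\,o_Ao_B-2K_1\,o_{(A}\iota_{B)}+K_0\,\iota_A\iota_B .$$ Here $K_{AB}$ is given conformal weight $2$, so that $K_1$ has GHP weight $\{0,0\}$ and conformal weight $1$, and $K_2$ has GHP weight $\{-2,0\}$ and conformal weight $0$. Then $K_{AB}$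 solves the projected Killing spinor equation $o^A\nabla_{A'(A}K_{BC)}=0$ if and only if $$K_0=0,\qquad \tilde{\mathcal C}_{A'}K_1=0,\qquad \tilde{\mathcal C}_{A'}K_2+2\,\mathcal C_{A'}K_1=0,$$ and equivalently, in GHP notation, if and only if $K_0=0$ and $$(\text{ð}+\tau)K_1=0,\qquad (\text{þ}+\rho)K_1=0,$$ $$2(\text{þ}'+\rho')K_1+(\text{ð}+2\tau)K_2=0,\qquad 2(\text{ð}'+\tau')K_1+(\text{þ}+2\rho)K_2=0 .$$ -/

import Mathlib

open scoped Manifold ContDiff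

noncomputable section

namespace Spacetime

/-- The model space of a four-dimensional manifold. -/
abbrev E4 : Type := EuclideanSpace ℝ (Fin 4)

variable {M : Type*} [TopologicalSpace M] [ChartedSpace E4 M]

/-- A (not necessarily smooth) real vector field on `M`. -/
abbrev VField (M : Type*) [TopologicalSpace M] [ChartedSpace E4 M] : Type _ :=
  ∀ x : M, TangentSpace 𝓘(ℝ, E4) x

/-- Smoothness of a vector field, as a section of the tangent bundle. -/
def SmoothVField [IsManifold 𝓘(ℝ, E4) ∞ M] (X : VField M) : Prop :=
  ContMDiff 𝓘(ℝ, E4) (𝓘(ℝ, E4).prod 𝓘(ℝ, E4)) ∞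
    (fun x => (⟨x, X x⟩ : TangentBundle 𝓘(ℝ, E4) M))

/-- Smoothness of a complex scalar field. -/
def SmoothScalar (f : M → ℂ) : Prop := ContMDiff 𝓘(ℝ, E4) 𝓘(ℝ, ℂ) ∞ f

/-- A smooth Lorentzian metric, of signature `(+,-,-,-)`, on the four-dimensional manifold `M`. -/
structure LorentzianMetric (M : Type*) [TopologicalSpace M] [ChartedSpace E4 M]
    [IsManifold 𝓘(ℝ, E4) ∞ M] where
  inner : ∀ x : M, TangentSpace 𝓘(ℝ, E4) x →L[ℝ] TangentSpace 𝓘(ℝ, E4) x →L[ℝ] ℝ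
  symm : ∀ (x : M) (v w : TangentSpace 𝓘(ℝ, E4) x), inner x v w = inner x w v
  signature : ∀ x : M, ∃ e : Module.Basis (Fin 4) ℝ (TangentSpace 𝓘(ℝ, E4) x),
    ∀ i j, inner x (e i) (e j) = if i = j then (if i = 0 then 1 else -1) else 0
  contMDiff : ContMDiff 𝓘(ℝ, E4) (𝓘(ℝ, E4).prod 𝓘(ℝ, E4 →L[ℝ] E4 →L[ℝ] ℝ)) ∞
    (fun x => Bundle.TotalSpace.mk' (E4 →L[ℝ] E4 →L[ℝ] ℝ)
      (E := fun x : M => TangentSpace 𝓘(ℝ, E4) x →L[ℝ] TangentSpace 𝓘(ℝ, E4) x →L[ℝ] ℝ)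
      x (inner x))

variable [IsManifold 𝓘(ℝ, E4) ∞ M]

namespace LorentzianMetric

/-- The function `g(X, Y)`. -/
def pair (g : LorentzianMetric M) (X Y : VField M) (x : M) : ℝ := g.inner x (X x) (Y x)

/-- `g(∇_X Y, Z)` for the Levi-Civita connection `∇` of `g`, given by the Koszul formula. -/
def koszul (g : LorentzianMetric M) (X Y Z : VField M) (x : M) : ℝ :=
  (1 / 2) *
    (mvfderiv 𝓘(ℝ, E4) (g.pair Y Z) x (X x)
      + mvfderiv 𝓘(ℝ, E4) (g.pair Z X) x (Y x)
      - mvfderiv 𝓘(ℝ, E4) (g.pair X Y) x (Z x)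
      + g.pair (VectorField.mlieBracket 𝓘(ℝ, E4) X Y) Z x
      - g.pair (VectorField.mlieBracket 𝓘(ℝ, E4) Y Z) X x
      + g.pair (VectorField.mlieBracket 𝓘(ℝ, E4) Z X) Y x)

lemma pair_comm (g : LorentzianMetric M) (X Y : VField M) : g.pair X Y = g.pair Y X :=
  funext fun x => g.symm x _ _

lemma pair_bracket_swap (g : LorentzianMetric M) (X Y Z : VField M) (x : M) :
    g.pair (VectorField.mlieBracket 𝓘(ℝ, E4) X Y) Z x
      = - g.pair (VectorField.mlieBracket 𝓘(ℝ, E4) Y X) Z x := by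
  unfold pair
  rw [VectorField.mlieBracket_swap_apply, map_neg]
  rfl

/-- The connection defined by `koszul` is metric. -/
lemma koszul_metric (g : LorentzianMetric M) (X Y Z : VField M) (x : M) :
    g.koszul X Y Z x + g.koszul X Z Y x = mvfderiv 𝓘(ℝ, E4) (g.pair Y Z) x (X x) := by
  unfold koszul
  rw [g.pair_comm Z X, g.pair_comm Y X, g.pair_comm Z Y, g.pair_bracket_swap Z X Y,
    g.pair_bracket_swap Z Y X, g.pair_bracket_swap Y X Z]
  ring

/-- The connection defined by `koszul` is torsion-free. -/
lemma koszul_torsion_free (g : LorentzianMetric M) (X Y Z : VField M) (x : M) :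
    g.koszul X Y Z x - g.koszul Y X Z x
      = g.pair (VectorField.mlieBracket 𝓘(ℝ, E4) X Y) Z x := by
  unfold koszul
  rw [g.pair_comm Z X, g.pair_comm Z Y, g.pair_comm Y X, g.pair_bracket_swap Z X Y,
    g.pair_bracket_swap Z Y X, g.pair_bracket_swap Y X Z]
  ring

end LorentzianMetric

/-- A spin dyad `(o^A, ι^A)`, `o_A ι^A = 1`, on the spacetime `(M, g)`, given (up to the overall
sign of the dyad, on which nothing below depends) by its null tetrad
`l^a = o^A ō^{A'}`, `n^a = ι^A ῑ^{A'}`, `m^a = o^A ῑ^{A'}`, where `m = mRe + i mIm`.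
The conditions say that `l, n, m, m̄` are null, `l·n = 1`, `m·m̄ = -1` and that all other
products vanish, which is `g_{ab} = ε_{AB} ε̄_{A'B'}`.

The dyad trivialises the spin bundle, so that a spinor field is the same as the family of its
components in this dyad: a component index `A = 0` stands for contraction with `o^A`, and `A = 1`
for contraction with `ι^A`. -/
structure SpinDyad (g : LorentzianMetric M) where
  l : VField M
  n : VField M
  mRe : VField M
  mIm : VField M
  smooth_l : SmoothVField l
  smooth_n : SmoothVField n
  smooth_mRe : SmoothVField mRe
  smooth_mIm : SmoothVField mIm
  l_l : ∀ x, g.pair l l x = 0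
  n_n : ∀ x, g.pair n n x = 0
  l_n : ∀ x, g.pair l n x = 1
  l_mRe : ∀ x, g.pair l mRe x = 0
  l_mIm : ∀ x, g.pair l mIm x = 0
  n_mRe : ∀ x, g.pair n mRe x = 0
  n_mIm : ∀ x, g.pair n mIm x = 0
  mRe_mRe : ∀ x, g.pair mRe mRe x = -1 / 2
  mIm_mIm : ∀ x, g.pair mIm mIm x = -1 / 2
  mRe_mIm : ∀ x, g.pair mRe mIm x = 0

/-! ### Spinor algebra in the dyad -/

/-- Components of `ε_{AB}`, and also of `ε^{AB}`; and the same for the primed ones. -/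
def eps : Fin 2 → Fin 2 → ℂ := ![![0, 1], ![-1, 0]]

/-- Components of `o^A`. -/
def o : Fin 2 → ℂ := ![1, 0]

/-- Components of `ι^A`. -/
def iota : Fin 2 → ℂ := ![0, 1]

/-- Lowering of an index, `ξ_B = ξ^A ε_{AB}`. -/
def lower (ξ : Fin 2 → ℂ) (B : Fin 2) : ℂ := ∑ A, ξ A * eps A B

/-- Complex conjugation of spinors, `ξ^A ↦ ξ̄^{A'}`. -/
def conj (ξ : Fin 2 → ℂ) (A' : Fin 2) : ℂ := starRingEnd ℂ (ξ A')

/-- The components of the inverse of the Gram matrix of the real frame `(l, n, mRe, mIm)`. -/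
def etaInv : Fin 4 → Fin 4 → ℝ :=
  ![![0, 1, 0, 0], ![1, 0, 0, 0], ![0, 0, -2, 0], ![0, 0, 0, -2]]

/-- The coefficients of the complex vectors
`e_{00'} = l`, `e_{01'} = m`, `e_{10'} = m̄`, `e_{11'} = n` in the real frame
`(l, n, mRe, mIm)`. -/
def solder : Fin 2 → Fin 2 → Fin 4 → ℂ :=
  ![![![1, 0, 0, 0], ![0, 0, 1, Complex.I]],
    ![![0, 0, 1, -Complex.I], ![0, 1, 0, 0]]]

namespace SpinDyad

variable {g : LorentzianMetric M} (D : SpinDyad g)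

/-! ### Levi-Civita connection and curvature in the real frame `(l, n, mRe, mIm)` -/

/-- The real frame `(l, n, mRe, mIm)`. -/
def frame : Fin 4 → VField M := ![D.l, D.n, D.mRe, D.mIm]

/-- `Γ_{ijk} = g(∇_{b_i} b_j, b_k)` for the frame `b`. -/
def Gam (i j k : Fin 4) (x : M) : ℝ := g.koszul (D.frame i) (D.frame j) (D.frame k) x

/-- `Γ_{ij}^k`, where `∇_{b_i} b_j = Γ_{ij}^k b_k`. -/
def GamUp (i j k : Fin 4) (x : M) : ℝ := ∑ m, D.Gam i j m x * etaInv m k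

/-- The structure functions `c_{ij}^k`, where `[b_i, b_j] = c_{ij}^k b_k`. -/
def struct (i j k : Fin 4) (x : M) : ℝ :=
  ∑ m, g.pair (VectorField.mlieBracket 𝓘(ℝ, E4) (D.frame i) (D.frame j)) (D.frame m) x
    * etaInv m k

/-- The frame components `(∇_{b_i} V)^k` of the Levi-Civita derivative of `V = V^j b_j`. -/
def nabla (i : Fin 4) (V : Fin 4 → M → ℝ) (k : Fin 4) (x : M) : ℝ :=
  mvfderiv 𝓘(ℝ, E4) (V k) x (D.frame i x) + ∑ j, D.GamUp i j k x * V j x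

/-- The frame components of the frame vector `b_j`. -/
def unitVec (j : Fin 4) (k : Fin 4) (_ : M) : ℝ := if k = j then 1 else 0

/-- `(R(b_i, b_j) b_k)^m`, where
`R(b_i, b_j) V = ∇_{b_i} ∇_{b_j} V - ∇_{b_j} ∇_{b_i} V - ∇_{[b_i, b_j]} V`. -/
def riemUp (i j k m : Fin 4) (x : M) : ℝ :=
  D.nabla i (D.nabla j (unitVec k)) m x - D.nabla j (D.nabla i (unitVec k)) m x
    - ∑ r, D.struct i j r x * D.nabla r (unitVec k) m x

/-- The Riemann tensor `R_{abcd}` on frame vectors, `g(R(b_i, b_j) b_k, b_m)`. -/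
def riem (i j k m : Fin 4) (x : M) : ℝ :=
  ∑ r, D.riemUp i j k r x * g.pair (D.frame r) (D.frame m) x

/-! ### Spinor connection and Weyl spinor -/

/-- The derivative `∇_{AA'} f = e_{AA'}(f)` of a complex scalar field. -/
def dir (A A' : Fin 2) (f : M → ℂ) (x : M) : ℂ :=
  ∑ i, solder A A' i * mvfderiv 𝓘(ℝ, E4) f x (D.frame i x)

/-- `g(∇_{AA'} e_{BB'}, e_{CC'})`, extended complex linearly from the real frame. -/
def GamC (A A' B B' C C' : Fin 2) (x : M) : ℂ :=
  ∑ i, ∑ j, ∑ k, solder A A' i * solder B B' j * solder C C' k * (D.Gam i j k x : ℂ)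

/-- The coefficients `γ_{AA'BC} = ½ ε̄^{B'C'} g(∇_{AA'} e_{BB'}, e_{CC'})` of the spinor
Levi-Civita connection. -/
def spinGam (A A' B C : Fin 2) (x : M) : ℂ :=
  (1 / 2) * ∑ B', ∑ C', eps B' C' * D.GamC A A' B B' C C' x

/-- `γ_{AA'B}^C`: the derivative `∇_{AA'}` of the `B`-th dyad spinor is `γ_{AA'B}^C` times the
`C`-th dyad spinor, summed over `C`. -/
def spinGamUp (A A' B C : Fin 2) (x : M) : ℂ := ∑ E, eps C E * D.spinGam A A' B E x

/-- The components `∇_{AA'} ξ_B` of the derivative of a spinor field. -/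
def nabla1 (A A' : Fin 2) (ξ : Fin 2 → M → ℂ) (B : Fin 2) (x : M) : ℂ :=
  D.dir A A' (ξ B) x - ∑ E, D.spinGamUp A A' B E x * ξ E x

/-- The components `∇_{AA'} K_{BC}` of the derivative of a spinor field with two indices. -/
def nabla2 (A A' : Fin 2) (K : Fin 2 → Fin 2 → M → ℂ) (B C : Fin 2) (x : M) : ℂ :=
  D.dir A A' (K B C) x - ∑ E, D.spinGamUp A A' B E x * K E C x
    - ∑ E, D.spinGamUp A A' C E x * K B E x

/-- The Riemann tensor `R_{AA'BB'CC'EE'}` on the vectors `e_{AA'}`, extended complex linearly. -/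
def riemC (A A' B B' C C' E E' : Fin 2) (x : M) : ℂ :=
  ∑ i, ∑ j, ∑ k, ∑ m, solder A A' i * solder B B' j * solder C C' k * solder E E' m
    * (D.riem i j k m x : ℂ)

/-- The curvature spinor `X_{ABCE} = ¼ ε̄^{A'B'} ε̄^{C'E'} R_{AA'BB'CC'EE'}`, which is symmetric in
`AB` and in `CE`. -/
def curvX (A B C E : Fin 2) (x : M) : ℂ :=
  (1 / 4) * ∑ A', ∑ B', ∑ C', ∑ E', eps A' B' * eps C' E' * D.riemC A A' B B' C C' E E' x

/-- The Weyl spinor `Ψ_{ABCE} = X_{(ABCE)}`; as `X` is symmetric in each of its two pairs of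
indices, the total symmetrisation is the mean over the six choices of the first pair. -/
def weyl (A B C E : Fin 2) (x : M) : ℂ :=
  (1 / 6) * (D.curvX A B C E x + D.curvX A C B E x + D.curvX A E B C x
    + D.curvX B C A E x + D.curvX B E A C x + D.curvX C E A B x)

/-- `o^A` is a shear-free ray: `o^A o^B ∇_{AA'} o_B = 0`. -/
def IsShearFreeRay : Prop :=
  ∀ (A' : Fin 2) (x : M),
    ∑ A, ∑ B, o A * o B * D.nabla1 A A' (fun E _ => lower o E) B x = 0

/-- `o^A` is a repeated principal spinor: `Ψ_{ABCE} o^B o^C o^E = 0`. -/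
def IsRepeatedPrincipal : Prop :=
  ∀ (A : Fin 2) (x : M), ∑ B, ∑ C, ∑ E, D.weyl A B C E x * o B * o C * o E = 0

/-- `Ψ₂ = Ψ_{ABCE} o^A o^B ι^C ι^E`. -/
def psi2 (x : M) : ℂ :=
  ∑ A, ∑ B, ∑ C, ∑ E, D.weyl A B C E x * o A * o B * iota C * iota E

/-! ### GHP formalism -/

/-- `α^B v^a ∇_a β_B` for the vector `v^a = ξ^A ζ^{A'}` and spinors with constant dyad
components. -/
def coeff (α ξ ζ β : Fin 2 → ℂ) (x : M) : ℂ :=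
  ∑ A, ∑ A', ∑ B, ξ A * ζ A' * α B * D.nabla1 A A' (fun E _ => lower β E) B x

/-- `ρ = o^A δ' o_A`, `δ' = m̄^a ∇_a`. -/
def rho : M → ℂ := D.coeff o iota (conj o) o

/-- `τ = o^A D' o_A`, `D' = n^a ∇_a`. -/
def tau : M → ℂ := D.coeff o iota (conj iota) o

/-- `ρ' = -ι^A δ ι_A`, `δ = m^a ∇_a`. -/
def rho' : M → ℂ := - D.coeff iota o (conj iota) iota

/-- `τ' = -ι^A D ι_A`, `D = l^a ∇_a`. -/
def tau' : M → ℂ := - D.coeff iota o (conj o) iota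

/-- `ε = ι^A D o_A`. -/
def epsilon : M → ℂ := D.coeff iota o (conj o) o

/-- `β = ι^A δ o_A`. -/
def beta : M → ℂ := D.coeff iota o (conj iota) o

/-- `ε' = -o^A D' ι_A`. -/
def epsilon' : M → ℂ := - D.coeff o iota (conj iota) iota

/-- `β' = -o^A δ' ι_A`. -/
def beta' : M → ℂ := - D.coeff o iota (conj o) iota

/-- `þ` on scalars of weight `{p,q}`: `þ = D - p ε - q ε̄`. -/
def tho (p q : ℤ) (f : M → ℂ) (x : M) : ℂ :=
  D.dir 0 0 f x - p * D.epsilon x * f x - q * starRingEnd ℂ (D.epsilon x) * f x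

/-- `ð` on scalars of weight `{p,q}`: `ð = δ - p β + q β̄'`. -/
def edt (p q : ℤ) (f : M → ℂ) (x : M) : ℂ :=
  D.dir 0 1 f x - p * D.beta x * f x + q * starRingEnd ℂ (D.beta' x) * f x

/-- `þ'` on scalars of weight `{p,q}`: `þ' = D' + p ε' + q ε̄'`. -/
def tho' (p q : ℤ) (f : M → ℂ) (x : M) : ℂ :=
  D.dir 1 1 f x + p * D.epsilon' x * f x + q * starRingEnd ℂ (D.epsilon' x) * f x

/-- `ð'` on scalars of weight `{p,q}`: `ð' = δ' + p β' - q β̄`. -/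
def edt' (p q : ℤ) (f : M → ℂ) (x : M) : ℂ :=
  D.dir 1 0 f x + p * D.beta' x * f x - q * starRingEnd ℂ (D.beta x) * f x

/-! ### The conformal-GHP connection -/

/-- The covector `a l_a + b n_a + c m_a + d m̄_a`, where `l_a = o_A ō_{A'}`, `n_a = ι_A ῑ_{A'}`,
`m_a = o_A ῑ_{A'}`, `m̄_a = ι_A ō_{A'}`. -/
def covec (a b c d : ℂ) (A A' : Fin 2) : ℂ :=
  a * (lower o A * lower (conj o) A') + b * (lower iota A * lower (conj iota) A')
    + c * (lower o A * lower (conj iota) A') + d * (lower iota A * lower (conj o) A')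

/-- `ω_a = -ε n_a + ε' l_a - β' m_a + β m̄_a`. -/
def omega (A A' : Fin 2) (x : M) : ℂ :=
  covec (D.epsilon' x) (- D.epsilon x) (- D.beta' x) (D.beta x) A A'

/-- `B_a = -ρ n_a + τ m̄_a`. -/
def formB (A A' : Fin 2) (x : M) : ℂ := covec 0 (- D.rho x) 0 (D.tau x) A A'

/-- `f_a = ρ n_a + ρ' l_a - τ' m_a - τ m̄_a`. -/
def formF (A A' : Fin 2) (x : M) : ℂ :=
  covec (D.rho' x) (D.rho x) (- D.tau' x) (- D.tau x) A A'

/-- The conformal-GHP connection `C_{AA'} ψ = ∇_{AA'} ψ + (w f_{AA'} + p (ω_{AA'} + B_{AA'})) ψ`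
on a scalar `ψ` of GHP weight `{p,0}` and conformal weight `w`. -/
def confC (p w : ℤ) (ψ : M → ℂ) (A A' : Fin 2) (x : M) : ℂ :=
  D.dir A A' ψ x + (w * D.formF A A' x + p * (D.omega A A' x + D.formB A A' x)) * ψ x

/-- `C̃_{A'} = o^A C_{AA'}`. -/
def confTilde (p w : ℤ) (ψ : M → ℂ) (A' : Fin 2) (x : M) : ℂ :=
  ∑ A, o A * D.confC p w ψ A A' x

/-- `C_{A'} = ι^A C_{AA'}`. -/
def confIota (p w : ℤ) (ψ : M → ℂ) (A' : Fin 2) (x : M) : ℂ :=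
  ∑ A, iota A * D.confC p w ψ A A' x

/-! ### The projected Killing spinor equation -/

/-- `K_{AB} = K₂ o_A o_B - 2 K₁ o_{(A} ι_{B)} + K₀ ι_A ι_B`. -/
def spinorK (K0 K1 K2 : M → ℂ) (A B : Fin 2) (x : M) : ℂ :=
  K2 x * (lower o A * lower o B)
    - K1 x * (lower o A * lower iota B + lower iota A * lower o B)
    + K0 x * (lower iota A * lower iota B)

/-- The projected Killing spinor equation `o^A ∇_{A'(A} K_{BC)} = 0` for a symmetric spinor
field `K`. -/
def IsProjKillingSpinor (K : Fin 2 → Fin 2 → M → ℂ) : Prop :=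
  ∀ (A' B C : Fin 2) (x : M),
    ∑ A, o A * ((1 / 3) *
      (D.nabla2 A A' K B C x + D.nabla2 B A' K C A x + D.nabla2 C A' K A B x)) = 0

end SpinDyad

end Spacetime

end

noncomputable section

namespace Spacetime

variable {M : Type*} [TopologicalSpace M] [ChartedSpace E4 M]

section Derivatives

variable {F G : Type*} [NormedAddCommGroup F] [NormedSpace ℝ F]
  [NormedAddCommGroup G] [NormedSpace ℝ G]

/-- The derivative commutes with continuous linear maps. -/
lemma mvfderiv_clm_comp (L : F →L[ℝ] G) {f : M → F} {x : M}
    (hf : MDifferentiableAt 𝓘(ℝ, E4) 𝓘(ℝ, F) f x) (v : TangentSpace 𝓘(ℝ, E4) x) :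
    mvfderiv 𝓘(ℝ, E4) (fun y => L (f y)) x v = L (mvfderiv 𝓘(ℝ, E4) f x v) := by
  have h := (L.hasMFDerivAt (x := f x)).comp x hf.hasMFDerivAt
  have h' : mfderiv 𝓘(ℝ, E4) 𝓘(ℝ, G) (fun y => L (f y)) x = _ := h.mfderiv
  simp only [mvfderiv, h']
  rfl

lemma mvfderiv_finsetSum {ι : Type*} (s : Finset ι) {f : ι → M → F} {x : M}
    (hf : ∀ i, MDifferentiableAt 𝓘(ℝ, E4) 𝓘(ℝ, F) (f i) x) (v : TangentSpace 𝓘(ℝ, E4) x) :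
    mvfderiv 𝓘(ℝ, E4) (fun y => ∑ i ∈ s, f i y) x v = ∑ i ∈ s, mvfderiv 𝓘(ℝ, E4) (f i) x v := by
  suffices h : MDifferentiableAt 𝓘(ℝ, E4) 𝓘(ℝ, F) (fun y => ∑ i ∈ s, f i y) x ∧
      mvfderiv 𝓘(ℝ, E4) (fun y => ∑ i ∈ s, f i y) x v = ∑ i ∈ s, mvfderiv 𝓘(ℝ, E4) (f i) x v from
    h.2
  classical
  induction s using Finset.induction_on with
  | empty =>
    simp only [Finset.sum_empty, mvfderiv_const]
    exact ⟨mdifferentiableAt_const, rfl⟩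
  | insert a s ha ih =>
    simp only [Finset.sum_insert ha]
    refine ⟨(hf a).add ih.1, ?_⟩
    rw [mvfderiv_fun_add (hf a) ih.1, ← ih.2]
    rfl

lemma mvfderiv_complex_mul {f h : M → ℂ} {x : M}
    (hf : MDifferentiableAt 𝓘(ℝ, E4) 𝓘(ℝ, ℂ) f x) (hh : MDifferentiableAt 𝓘(ℝ, E4) 𝓘(ℝ, ℂ) h x)
    (v : TangentSpace 𝓘(ℝ, E4) x) :
    mvfderiv 𝓘(ℝ, E4) (fun y => f y * h y) x v
      = f x * mvfderiv 𝓘(ℝ, E4) h x v + mvfderiv 𝓘(ℝ, E4) f x v * h x := by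
  have h' : mfderiv 𝓘(ℝ, E4) 𝓘(ℝ, ℂ) (fun y => f y * h y) x = _ :=
    (hf.hasMFDerivAt.mul' hh.hasMFDerivAt).mfderiv
  simp only [mvfderiv, h']
  rfl

variable [IsManifold 𝓘(ℝ, E4) ∞ M]

/-- The derivative of a smooth function along a smooth vector field is smooth. -/
lemma contMDiff_mvfderiv_apply {f : M → F} (hf : ContMDiff 𝓘(ℝ, E4) 𝓘(ℝ, F) ∞ f)
    {X : VField M} (hX : SmoothVField X) :
    ContMDiff 𝓘(ℝ, E4) 𝓘(ℝ, F) ∞ (fun x => mvfderiv 𝓘(ℝ, E4) f x (X x)) := by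
  have h1 := (hf.contMDiff_tangentMap (m := ∞) (by simp)).comp hX
  exact (contMDiff_snd_tangentBundle_modelSpace F 𝓘(ℝ, F)).comp h1

lemma SmoothVField.mlieBracket {X Y : VField M} (hX : SmoothVField X) (hY : SmoothVField Y) :
    SmoothVField (VectorField.mlieBracket 𝓘(ℝ, E4) X Y) := by
  have : IsManifold 𝓘(ℝ, E4) ((∞ : WithTop ℕ∞) + 1) M := by simpa
  have : IsManifold 𝓘(ℝ, E4) (minSmoothness ℝ 2) M := by
    simp only [minSmoothness_of_isRCLikeNormedField]
    exact IsManifold.of_le (n := ∞) ENat.LEInfty.out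
  exact ContDiff.mlieBracket_vectorField (m := ⊤) (n := ⊤) hX hY (by simp)

lemma SmoothVField.mdifferentiableAt {X : VField M} (hX : SmoothVField X) (x : M) :
    MDifferentiableAt 𝓘(ℝ, E4) (𝓘(ℝ, E4).prod 𝓘(ℝ, E4))
      (fun x => (⟨x, X x⟩ : TangentBundle 𝓘(ℝ, E4) M)) x :=
  (hX x).mdifferentiableAt (by simp)

lemma SmoothVField.add {X Y : VField M} (hX : SmoothVField X) (hY : SmoothVField Y) :
    SmoothVField (X + Y) := ContMDiff.add_section hX hY

lemma SmoothVField.smul {f : M → ℝ} {X : VField M} (hf : ContMDiff 𝓘(ℝ, E4) 𝓘(ℝ, ℝ) ∞ f)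
    (hX : SmoothVField X) : SmoothVField (f • X) := ContMDiff.smul_section hf hX

lemma LorentzianMetric.contMDiff_pair (g : LorentzianMetric M) {X Y : VField M}
    (hX : SmoothVField X) (hY : SmoothVField Y) :
    ContMDiff 𝓘(ℝ, E4) 𝓘(ℝ, ℝ) ∞ (g.pair X Y) := by
  have h := g.contMDiff.clm_bundle_apply₂ (F₁ := E4) (F₂ := E4) (F₃ := ℝ)
    (E₃ := Bundle.Trivial M ℝ) hX hY
  intro x
  exact (Bundle.contMDiffAt_totalSpace.1 (h x)).2

/-- The Jacobi identity for smooth vector fields. -/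
lemma jacobi_mlieBracket {X Y Z : VField M} (hX : SmoothVField X) (hY : SmoothVField Y)
    (hZ : SmoothVField Z) (x : M) :
    VectorField.mlieBracket 𝓘(ℝ, E4) X (VectorField.mlieBracket 𝓘(ℝ, E4) Y Z) x
      = VectorField.mlieBracket 𝓘(ℝ, E4) (VectorField.mlieBracket 𝓘(ℝ, E4) X Y) Z x
        + VectorField.mlieBracket 𝓘(ℝ, E4) Y (VectorField.mlieBracket 𝓘(ℝ, E4) X Z) x := by
  have : IsManifold 𝓘(ℝ, E4) (minSmoothness ℝ 3) M := by
    simp only [minSmoothness_of_isRCLikeNormedField]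
    exact IsManifold.of_le (n := ∞) ENat.LEInfty.out
  have h2 : minSmoothness ℝ 2 ≤ (∞ : WithTop ℕ∞) := by
    simp only [minSmoothness_of_isRCLikeNormedField]
    exact ENat.LEInfty.out
  exact VectorField.leibniz_identity_mlieBracket_apply ((hX x).of_le h2) ((hY x).of_le h2)
    ((hZ x).of_le h2)

/-- `[X, Y] f = X (Y f) - Y (X f)`, for real functions: the Jacobi identity for `X`, `Y` and
`f Z`, where `Z` does not vanish at the given point. -/
lemma mvfderiv_mlieBracket_real {f : M → ℝ} (hf : ContMDiff 𝓘(ℝ, E4) 𝓘(ℝ, ℝ) ∞ f)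
    {X Y Z : VField M} (hX : SmoothVField X) (hY : SmoothVField Y) (hZ : SmoothVField Z)
    {x : M} (hZx : Z x ≠ 0) :
    mvfderiv 𝓘(ℝ, E4) f x (VectorField.mlieBracket 𝓘(ℝ, E4) X Y x)
      = mvfderiv 𝓘(ℝ, E4) (fun y => mvfderiv 𝓘(ℝ, E4) f y (Y y)) x (X x)
        - mvfderiv 𝓘(ℝ, E4) (fun y => mvfderiv 𝓘(ℝ, E4) f y (X y)) x (Y x) := by
  have : IsManifold 𝓘(ℝ, E4) 2 M := IsManifold.of_le (n := ∞) ENat.LEInfty.out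
  have md : ∀ {h : M → ℝ}, ContMDiff 𝓘(ℝ, E4) 𝓘(ℝ, ℝ) ∞ h → ∀ y,
      MDifferentiableAt 𝓘(ℝ, E4) 𝓘(ℝ, ℝ) h y := fun hh y => (hh y).mdifferentiableAt (by simp)
  have key : ∀ {V W : VField M} {h : M → ℝ}, ContMDiff 𝓘(ℝ, E4) 𝓘(ℝ, ℝ) ∞ h → SmoothVField W →
      VectorField.mlieBracket 𝓘(ℝ, E4) V (h • W)
        = (fun y => mvfderiv 𝓘(ℝ, E4) h y (V y)) • W
          + h • VectorField.mlieBracket 𝓘(ℝ, E4) V W := by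
    intro V W h hh hW
    funext y
    exact VectorField.mlieBracket_smul_right (md hh y) (hW.mdifferentiableAt y)
  have two : ∀ {V W : VField M}, SmoothVField V → SmoothVField W →
      VectorField.mlieBracket 𝓘(ℝ, E4) V (VectorField.mlieBracket 𝓘(ℝ, E4) W (f • Z)) x
        = (mvfderiv 𝓘(ℝ, E4) (fun y => mvfderiv 𝓘(ℝ, E4) f y (W y)) x (V x)) • Z x
          + (mvfderiv 𝓘(ℝ, E4) f x (W x)) • VectorField.mlieBracket 𝓘(ℝ, E4) V Z x
          + ((mvfderiv 𝓘(ℝ, E4) f x (V x)) • VectorField.mlieBracket 𝓘(ℝ, E4) W Z x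
          + f x • VectorField.mlieBracket 𝓘(ℝ, E4) V
              (VectorField.mlieBracket 𝓘(ℝ, E4) W Z) x) := by
    intro V W hV hW
    have hdf := contMDiff_mvfderiv_apply hf hW
    have hWZ := hW.mlieBracket hZ
    rw [key hf hZ, VectorField.mlieBracket_add_right ((hZ.smul hdf).mdifferentiableAt x)
      ((hWZ.smul hf).mdifferentiableAt x), key hdf hZ, key hf hWZ]
    rfl
  have J := jacobi_mlieBracket hX hY (hZ.smul hf) x
  rw [two hX hY, two hY hX, key hf hZ] at J
  have J' := jacobi_mlieBracket hX hY hZ x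
  simp only [Pi.add_apply, Pi.smul_apply'] at J
  rw [J'] at J
  have : (mvfderiv 𝓘(ℝ, E4) (fun y => mvfderiv 𝓘(ℝ, E4) f y (Y y)) x (X x)
      - mvfderiv 𝓘(ℝ, E4) (fun y => mvfderiv 𝓘(ℝ, E4) f y (X y)) x (Y x)
      - mvfderiv 𝓘(ℝ, E4) f x (VectorField.mlieBracket 𝓘(ℝ, E4) X Y x)) • Z x = 0 := by
    rw [sub_smul, sub_smul]
    rw [← sub_eq_zero] at J
    rw [← J]
    simp only [smul_add]
    abel
  rcases smul_eq_zero.1 this with h | h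
  · linarith
  · exact absurd h hZx

/-- `[X, Y] f = X (Y f) - Y (X f)`, for complex functions. -/
lemma mvfderiv_mlieBracket_complex {f : M → ℂ} (hf : SmoothScalar f)
    {X Y Z : VField M} (hX : SmoothVField X) (hY : SmoothVField Y) (hZ : SmoothVField Z)
    {x : M} (hZx : Z x ≠ 0) :
    mvfderiv 𝓘(ℝ, E4) f x (VectorField.mlieBracket 𝓘(ℝ, E4) X Y x)
      = mvfderiv 𝓘(ℝ, E4) (fun y => mvfderiv 𝓘(ℝ, E4) f y (Y y)) x (X x)
        - mvfderiv 𝓘(ℝ, E4) (fun y => mvfderiv 𝓘(ℝ, E4) f y (X y)) x (Y x) := by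
  have md : ∀ {h : M → ℂ}, ContMDiff 𝓘(ℝ, E4) 𝓘(ℝ, ℂ) ∞ h → ∀ y,
      MDifferentiableAt 𝓘(ℝ, E4) 𝓘(ℝ, ℂ) h y := fun hh y => (hh y).mdifferentiableAt (by simp)
  have part : ∀ L : ℂ →L[ℝ] ℝ,
      L (mvfderiv 𝓘(ℝ, E4) f x (VectorField.mlieBracket 𝓘(ℝ, E4) X Y x))
      = L (mvfderiv 𝓘(ℝ, E4) (fun y => mvfderiv 𝓘(ℝ, E4) f y (Y y)) x (X x)
        - mvfderiv 𝓘(ℝ, E4) (fun y => mvfderiv 𝓘(ℝ, E4) f y (X y)) x (Y x)) := by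
    intro L
    have hL : ContMDiff 𝓘(ℝ, E4) 𝓘(ℝ, ℝ) ∞ (fun y => L (f y)) :=
      L.contMDiff.comp hf
    have := mvfderiv_mlieBracket_real hL hX hY hZ hZx
    simp only [mvfderiv_clm_comp L (md hf _)] at this
    rw [mvfderiv_clm_comp L (md (contMDiff_mvfderiv_apply hf hY) _),
      mvfderiv_clm_comp L (md (contMDiff_mvfderiv_apply hf hX) _)] at this
    rw [this, map_sub]
  exact Complex.ext (part Complex.reCLM) (part Complex.imCLM)

end Derivatives

end Spacetime

end

noncomputable section

namespace Spacetime

variable {M : Type*} [TopologicalSpace M] [ChartedSpace E4 M] [IsManifold 𝓘(ℝ, E4) ∞ M]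

/-- The Gram matrix of the real frame `(l, n, mRe, mIm)`. -/
def eta : Fin 4 → Fin 4 → ℝ :=
  ![![0, 1, 0, 0], ![1, 0, 0, 0], ![0, 0, -1 / 2, 0], ![0, 0, 0, -1 / 2]]

/-- The inverse metric applied to two covectors in the real frame `(l, n, mRe, mIm)`. -/
def contr {R : Type*} [CommRing R] (u v : Fin 4 → R) : R :=
  u 0 * v 1 + u 1 * v 0 - 2 * (u 2 * v 2) - 2 * (u 3 * v 3)

lemma sum_mul_etaInv (u : Fin 4 → ℝ) (k : Fin 4) :
    ∑ m, u m * etaInv m k = ![u 1, u 0, -2 * u 2, -2 * u 3] k := by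
  fin_cases k <;> simp [Fin.sum_univ_four, etaInv, mul_comm]

lemma sum_mul_eta (u : Fin 4 → ℝ) (m : Fin 4) :
    ∑ r, u r * eta r m = ![u 1, u 0, -1 / 2 * u 2, -1 / 2 * u 3] m := by
  fin_cases m <;> simp [Fin.sum_univ_four, eta, mul_comm]

lemma sum_raise_mul (u v : Fin 4 → ℝ) :
    ∑ r, (∑ m, u m * etaInv m r) * v r = contr u v := by
  simp_rw [sum_mul_etaInv]
  simp [Fin.sum_univ_four, contr]
  ring

lemma lower_raise (u : Fin 4 → ℝ) (m : Fin 4) :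
    ∑ r, (∑ k, u k * etaInv k r) * eta r m = u m := by
  simp only [sum_mul_etaInv, sum_mul_eta]
  fin_cases m <;> simp <;> ring

lemma raise_lower (u : Fin 4 → ℝ) (k : Fin 4) :
    ∑ m, (∑ r, u r * eta r m) * etaInv m k = u k := by
  simp only [sum_mul_etaInv, sum_mul_eta]
  fin_cases k <;> simp <;> ring

namespace SpinDyad

variable {g : LorentzianMetric M} (D : SpinDyad g)

/-- The derivative of a function along the frame vector `b_i`. -/
def der {F : Type*} [NormedAddCommGroup F] [NormedSpace ℝ F] (i : Fin 4) (f : M → F) (x : M) : F :=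
  mvfderiv 𝓘(ℝ, E4) f x (D.frame i x)

lemma smooth_frame (i : Fin 4) : SmoothVField (D.frame i) := by
  fin_cases i
  exacts [D.smooth_l, D.smooth_n, D.smooth_mRe, D.smooth_mIm]

lemma pair_frame (i j : Fin 4) (x : M) : g.pair (D.frame i) (D.frame j) x = eta i j := by
  have h : ∀ X Y : VField M, g.pair X Y x = g.pair Y X x := fun X Y => congrFun (g.pair_comm X Y) x
  fin_cases i <;> fin_cases j <;>
    simp [frame, eta, D.l_l, D.n_n, D.l_n, D.l_mRe, D.l_mIm, D.n_mRe, D.n_mIm, D.mRe_mRe,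
      D.mIm_mIm, D.mRe_mIm, h D.n D.l, h D.mRe D.l, h D.mIm D.l, h D.mRe D.n, h D.mIm D.n,
      h D.mIm D.mRe]

lemma frame_zero_ne_zero (x : M) : D.frame 0 x ≠ 0 := by
  intro h
  have := D.pair_frame 0 1 x
  simp [LorentzianMetric.pair, h, eta] at this

/-- The frame components of a tangent vector. -/
def coord (x : M) (v : TangentSpace 𝓘(ℝ, E4) x) (k : Fin 4) : ℝ :=
  ∑ m, g.inner x v (D.frame m x) * etaInv m k

lemma coord_sum (x : M) (c : Fin 4 → ℝ) (k : Fin 4) :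
    D.coord x (∑ r, c r • D.frame r x) k = c k := by
  have h : ∀ m, g.inner x (∑ r, c r • D.frame r x) (D.frame m x) = ∑ r, c r * eta r m := by
    intro m
    simp only [← D.pair_frame _ m x, LorentzianMetric.pair]
    simp
  simp only [coord, h, raise_lower]

lemma coord_add (x : M) (v w : TangentSpace 𝓘(ℝ, E4) x) (k : Fin 4) :
    D.coord x (v + w) k = D.coord x v k + D.coord x w k := by
  simp [coord, add_mul, Finset.sum_add_distrib]

lemma coord_smul (x : M) (c : ℝ) (v : TangentSpace 𝓘(ℝ, E4) x) (k : Fin 4) :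
    D.coord x (c • v) k = c * D.coord x v k := by
  simp [coord, Finset.mul_sum, mul_assoc]

lemma coord_frame (x : M) (i k : Fin 4) :
    D.coord x (D.frame i x) k = if i = k then 1 else 0 := by
  have h := D.coord_sum x (fun r => if i = r then 1 else 0) k
  simpa using h

/-- The frame is a basis of every tangent space. -/
lemma sum_coord (x : M) (v : TangentSpace 𝓘(ℝ, E4) x) :
    ∑ k, D.coord x v k • D.frame k x = v := by
  have hli : LinearIndependent ℝ (fun i => D.frame i x) := by
    rw [Fintype.linearIndependent_iff]
    intro c hc i
    rw [← D.coord_sum x c i, hc]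
    simp [coord]
  have hcard : Fintype.card (Fin 4) = Module.finrank ℝ (TangentSpace 𝓘(ℝ, E4) x) := by
    change _ = Module.finrank ℝ E4
    simp
  have : FiniteDimensional ℝ (TangentSpace 𝓘(ℝ, E4) x) := inferInstanceAs (FiniteDimensional ℝ E4)
  have hspan := hli.span_eq_top_of_card_eq_finrank' hcard
  have hv : v ∈ Submodule.span ℝ (Set.range fun i => D.frame i x) := by
    rw [hspan]; trivial
  obtain ⟨c, rfl⟩ := (Submodule.mem_span_range_iff_exists_fun ℝ).1 hv
  simp only [D.coord_sum]

lemma struct_eq_coord (i j k : Fin 4) (x : M) :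
    D.struct i j k x
      = D.coord x (VectorField.mlieBracket 𝓘(ℝ, E4) (D.frame i) (D.frame j) x) k := rfl

lemma mlieBracket_frame (i j : Fin 4) :
    VectorField.mlieBracket 𝓘(ℝ, E4) (D.frame i) (D.frame j)
      = D.struct i j 0 • D.frame 0 + D.struct i j 1 • D.frame 1
        + D.struct i j 2 • D.frame 2 + D.struct i j 3 • D.frame 3 := by
  funext x
  conv_lhs => rw [← D.sum_coord x (VectorField.mlieBracket 𝓘(ℝ, E4) (D.frame i) (D.frame j) x)]
  rw [Fin.sum_univ_four]
  rfl

lemma contMDiff_struct (i j k : Fin 4) :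
    ContMDiff 𝓘(ℝ, E4) 𝓘(ℝ, ℝ) ∞ (D.struct i j k) := by
  unfold struct
  refine contMDiff_finsetSum fun m _ => ContMDiff.mul ?_ contMDiff_const
  exact g.contMDiff_pair ((D.smooth_frame i).mlieBracket (D.smooth_frame j)) (D.smooth_frame m)

lemma mvfderiv_pair_frame (i j : Fin 4) (x : M) :
    mvfderiv 𝓘(ℝ, E4) (g.pair (D.frame i) (D.frame j)) x = 0 := by
  have h : g.pair (D.frame i) (D.frame j) = fun _ => eta i j := funext fun y => D.pair_frame i j y
  rw [h, mvfderiv_const]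

lemma contMDiff_Gam (i j k : Fin 4) : ContMDiff 𝓘(ℝ, E4) 𝓘(ℝ, ℝ) ∞ (D.Gam i j k) := by
  have hp : ∀ p q r : Fin 4, ContMDiff 𝓘(ℝ, E4) 𝓘(ℝ, ℝ) ∞
      (g.pair (VectorField.mlieBracket 𝓘(ℝ, E4) (D.frame p) (D.frame q)) (D.frame r)) :=
    fun p q r => g.contMDiff_pair ((D.smooth_frame p).mlieBracket (D.smooth_frame q))
      (D.smooth_frame r)
  have h : D.Gam i j k = fun x => (1 / 2 : ℝ) *
      (g.pair (VectorField.mlieBracket 𝓘(ℝ, E4) (D.frame i) (D.frame j)) (D.frame k) x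
      - g.pair (VectorField.mlieBracket 𝓘(ℝ, E4) (D.frame j) (D.frame k)) (D.frame i) x
      + g.pair (VectorField.mlieBracket 𝓘(ℝ, E4) (D.frame k) (D.frame i)) (D.frame j) x) := by
    funext x
    simp [Gam, LorentzianMetric.koszul, mvfderiv_pair_frame]
  rw [h]
  exact ContMDiff.mul contMDiff_const (((hp i j k).sub (hp j k i)).add (hp k i j))

lemma Gam_antisymm (i j k : Fin 4) (x : M) : D.Gam i j k x = - D.Gam i k j x := by
  have h := g.koszul_metric (D.frame i) (D.frame j) (D.frame k) x
  rw [mvfderiv_pair_frame] at h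
  simp only [Gam]
  simpa [add_eq_zero_iff_eq_neg] using h

lemma struct_eq_GamUp (i j k : Fin 4) (x : M) :
    D.struct i j k x = D.GamUp i j k x - D.GamUp j i k x := by
  simp only [struct, GamUp, ← g.koszul_torsion_free, Gam, ← Finset.sum_sub_distrib, sub_mul]

lemma contMDiff_GamUp (i j k : Fin 4) : ContMDiff 𝓘(ℝ, E4) 𝓘(ℝ, ℝ) ∞ (D.GamUp i j k) := by
  unfold GamUp
  exact contMDiff_finsetSum fun m _ => ContMDiff.mul (D.contMDiff_Gam i j m) contMDiff_const

lemma der_struct (p i j k : Fin 4) (x : M) :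
    D.der p (D.struct i j k) x = D.der p (D.GamUp i j k) x - D.der p (D.GamUp j i k) x := by
  have h : D.struct i j k = D.GamUp i j k - D.GamUp j i k :=
    funext fun y => D.struct_eq_GamUp i j k y
  rw [der, h, mvfderiv_sub ((D.contMDiff_GamUp i j k x).mdifferentiableAt (by simp))
    ((D.contMDiff_GamUp j i k x).mdifferentiableAt (by simp))]
  rfl

/-- Frame components of `[b_i, [b_j, b_k]]`. -/
lemma coord_mlieBracket_mlieBracket (i j k m : Fin 4) (x : M) :
    D.coord x (VectorField.mlieBracket 𝓘(ℝ, E4) (D.frame i)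
        (VectorField.mlieBracket 𝓘(ℝ, E4) (D.frame j) (D.frame k)) x) m
      = D.der i (D.struct j k m) x + ∑ r, D.struct j k r x * D.struct i r m x := by
  have : IsManifold 𝓘(ℝ, E4) 2 M := IsManifold.of_le (n := ∞) ENat.LEInfty.out
  have hs : ∀ r, SmoothVField (D.struct j k r • D.frame r) := fun r =>
    (D.smooth_frame r).smul (D.contMDiff_struct j k r)
  have hb : ∀ r, VectorField.mlieBracket 𝓘(ℝ, E4) (D.frame i) (D.struct j k r • D.frame r) x
      = D.der i (D.struct j k r) x • D.frame r x
        + D.struct j k r x • VectorField.mlieBracket 𝓘(ℝ, E4) (D.frame i) (D.frame r) x := fun r =>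
    VectorField.mlieBracket_smul_right ((D.contMDiff_struct j k r x).mdifferentiableAt (by simp))
      ((D.smooth_frame r).mdifferentiableAt x)
  rw [D.mlieBracket_frame j k,
    VectorField.mlieBracket_add_right ((((hs 0).add (hs 1)).add (hs 2)).mdifferentiableAt x)
      ((hs 3).mdifferentiableAt x),
    VectorField.mlieBracket_add_right (((hs 0).add (hs 1)).mdifferentiableAt x)
      ((hs 2).mdifferentiableAt x),
    VectorField.mlieBracket_add_right ((hs 0).mdifferentiableAt x) ((hs 1).mdifferentiableAt x)]
  simp only [hb, coord_add, coord_smul, coord_frame, ← struct_eq_coord, Fin.sum_univ_four]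
  fin_cases m <;> simp <;> ring

/-- The Jacobi identity for the structure functions. -/
lemma jacobi_struct (i j k m : Fin 4) (x : M) :
    D.der i (D.struct j k m) x + ∑ r, D.struct j k r x * D.struct i r m x
      + (D.der k (D.struct i j m) x + ∑ r, D.struct i j r x * D.struct k r m x)
      = D.der j (D.struct i k m) x + ∑ r, D.struct i k r x * D.struct j r m x := by
  have J := jacobi_mlieBracket (D.smooth_frame i) (D.smooth_frame j) (D.smooth_frame k) x
  rw [VectorField.mlieBracket_swap_apply (W := D.frame k), ← neg_one_smul ℝ] at J
  have J' := congrArg (fun v => D.coord x v m) J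
  simp only [coord_add, coord_smul, coord_mlieBracket_mlieBracket] at J'
  rw [J']
  ring

lemma nabla_unitVec (i k m : Fin 4) : D.nabla i (unitVec k) m = D.GamUp i k m := by
  funext x
  have h : (unitVec k m : M → ℝ) = fun _ => if m = k then 1 else 0 := rfl
  simp only [nabla, h, mvfderiv_const]
  simp [unitVec]

lemma riemUp_eq (i j k m : Fin 4) (x : M) :
    D.riemUp i j k m x = D.der i (D.GamUp j k m) x - D.der j (D.GamUp i k m) x
      + ∑ r, D.GamUp j k r x * D.GamUp i r m x - ∑ r, D.GamUp i k r x * D.GamUp j r m x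
      - ∑ r, D.struct i j r x * D.GamUp r k m x := by
  have h : ∀ p q : Fin 4, D.nabla p (D.nabla q (unitVec k)) m x
      = D.der p (D.GamUp q k m) x + ∑ r, D.GamUp q k r x * D.GamUp p r m x := by
    intro p q
    have h' : D.nabla q (unitVec k) = D.GamUp q k := funext fun s => D.nabla_unitVec q k s
    rw [h']
    simp only [nabla, der, mul_comm]
  simp only [riemUp, h, nabla_unitVec]
  ring

/-- The first Bianchi identity. -/
lemma riemUp_bianchi (i j k m : Fin 4) (x : M) :
    D.riemUp i j k m x + D.riemUp j k i m x + D.riemUp k i j m x = 0 := by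
  have J := D.jacobi_struct i j k m x
  simp only [riemUp_eq, der_struct, Fin.sum_univ_four, struct_eq_GamUp] at J ⊢
  linear_combination J

lemma riem_bianchi (i j k m : Fin 4) (x : M) :
    D.riem i j k m x + D.riem j k i m x + D.riem k i j m x = 0 := by
  simp only [riem, ← Finset.sum_add_distrib, ← add_mul, riemUp_bianchi]
  simp

lemma GamUp_lower (i j m : Fin 4) (x : M) : ∑ r, D.GamUp i j r x * eta r m = D.Gam i j m x :=
  lower_raise (fun m => D.Gam i j m x) m

lemma der_GamUp_lower (p i j m : Fin 4) (x : M) :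
    ∑ r, D.der p (D.GamUp i j r) x * eta r m = D.der p (D.Gam i j m) x := by
  have h2 : ∀ r, D.der p (D.GamUp i j r) x = ∑ k, D.der p (D.Gam i j k) x * etaInv k r := by
    intro r
    have hd : ∀ k, MDifferentiableAt 𝓘(ℝ, E4) 𝓘(ℝ, ℝ) (D.Gam i j k) x := fun k =>
      (D.contMDiff_Gam i j k x).mdifferentiableAt (by simp)
    have hc : ∀ k, mvfderiv 𝓘(ℝ, E4) (fun y => D.Gam i j k y * etaInv k r) x (D.frame p x)
        = D.der p (D.Gam i j k) x * etaInv k r := fun k => by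
      simpa [mul_comm, der] using
        mvfderiv_clm_comp (etaInv k r • ContinuousLinearMap.id ℝ ℝ) (hd k) (D.frame p x)
    unfold GamUp
    rw [der, mvfderiv_finsetSum (f := fun k y => D.Gam i j k y * etaInv k r) _
      fun k => (hd k).mul mdifferentiableAt_const]
    exact Finset.sum_congr rfl fun k _ => hc k
  simp only [h2]
  exact lower_raise (fun m => D.der p (D.Gam i j m) x) m

/-- The Riemann tensor in terms of the connection coefficients. -/
lemma riem_eq (i j k m : Fin 4) (x : M) :
    D.riem i j k m x = D.der i (D.Gam j k m) x - D.der j (D.Gam i k m) x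
      - contr (fun r => D.Gam j k r x) (fun r => D.Gam i m r x)
      + contr (fun r => D.Gam i k r x) (fun r => D.Gam j m r x)
      - contr (fun r => D.Gam i j r x - D.Gam j i r x) (fun r => D.Gam r k m x) := by
  have h1 : ∀ p q : Fin 4, ∑ s, (∑ r, D.GamUp p k r x * D.GamUp q r s x) * eta s m
      = - contr (fun r => D.Gam p k r x) (fun r => D.Gam q m r x) := by
    intro p q
    simp only [Finset.sum_mul]
    rw [Finset.sum_comm]
    simp only [mul_assoc, ← Finset.mul_sum, GamUp_lower]
    simp only [GamUp, D.Gam_antisymm q _ m]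
    rw [sum_raise_mul]
    simp only [contr]
    ring
  have h2 : ∑ s, (∑ r, D.struct i j r x * D.GamUp r k s x) * eta s m
      = contr (fun r => D.Gam i j r x - D.Gam j i r x) (fun r => D.Gam r k m x) := by
    simp only [Finset.sum_mul]
    rw [Finset.sum_comm]
    simp only [mul_assoc, ← Finset.mul_sum, GamUp_lower]
    simp only [struct_eq_GamUp, GamUp, ← Finset.sum_sub_distrib, ← sub_mul]
    rw [sum_raise_mul]
  simp only [riem, pair_frame, riemUp_eq, sub_mul, add_mul, Finset.sum_sub_distrib,
    Finset.sum_add_distrib, h1, h2, der_GamUp_lower]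
  ring

lemma der_Gam_antisymm (p i j k : Fin 4) (x : M) :
    D.der p (D.Gam i j k) x = - D.der p (D.Gam i k j) x := by
  have h : D.Gam i j k = - D.Gam i k j := funext fun y => D.Gam_antisymm i j k y
  rw [der, h, mvfderiv_neg]
  rfl

lemma riem_antisymm_left (i j k m : Fin 4) (x : M) : D.riem i j k m x = - D.riem j i k m x := by
  simp only [riem_eq, contr]
  ring

lemma riem_antisymm_right (i j k m : Fin 4) (x : M) : D.riem i j k m x = - D.riem i j m k x := by
  simp only [riem_eq, contr, D.der_Gam_antisymm _ _ m k, D.Gam_antisymm _ m k]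
  ring

lemma riem_pair_symm (i j k m : Fin 4) (x : M) : D.riem i j k m x = D.riem k m i j x := by
  have h1 := D.riem_bianchi i j k m x
  have h2 := D.riem_bianchi j k m i x
  have h3 := D.riem_bianchi k m i j x
  have h4 := D.riem_bianchi m i j k x
  linarith [D.riem_antisymm_left k i j m x, D.riem_antisymm_right k i j m x,
    D.riem_antisymm_right j k i m x, D.riem_antisymm_right i j k m x,
    D.riem_antisymm_right k m i j x, D.riem_antisymm_right m i j k x,
    D.riem_antisymm_left j m k i x, D.riem_antisymm_right j m k i x,
    D.riem_antisymm_left i k m j x, D.riem_antisymm_right m j k i x]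

/-- Commutator of the frame derivatives. -/
lemma der_comm {f : M → ℂ} (hf : SmoothScalar f) (i j : Fin 4) (x : M) :
    D.der i (D.der j f) x - D.der j (D.der i f) x
      = contr (fun r => ((D.Gam i j r x - D.Gam j i r x : ℝ) : ℂ)) (fun r => D.der r f x) := by
  have h := mvfderiv_mlieBracket_complex hf (D.smooth_frame i) (D.smooth_frame j)
    (D.smooth_frame 0) (D.frame_zero_ne_zero x)
  change _ = D.der i (D.der j f) x - D.der j (D.der i f) x at h
  rw [← h, D.mlieBracket_frame]
  have h1 : ∀ r, D.struct i j r x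
      = ![D.Gam i j 1 x - D.Gam j i 1 x, D.Gam i j 0 x - D.Gam j i 0 x,
        -2 * (D.Gam i j 2 x - D.Gam j i 2 x), -2 * (D.Gam i j 3 x - D.Gam j i 3 x)] r := by
    intro r
    rw [← sum_mul_etaInv (fun m => D.Gam i j m x - D.Gam j i m x), struct_eq_GamUp]
    simp only [GamUp, sub_mul, Finset.sum_sub_distrib]
  simp only [Pi.add_apply, Pi.smul_apply', map_add, map_smul, h1, contr, der]
  simp
  ring

end SpinDyad

end Spacetime

end

noncomputable section

namespace Spacetime

variable {M : Type*} [TopologicalSpace M] [ChartedSpace E4 M]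

/-- The inverse metric applied to two covectors in the null tetrad `e_{AA'}`. -/
def contrC (u v : Fin 2 → Fin 2 → ℂ) : ℂ :=
  u 0 0 * v 1 1 + u 1 1 * v 0 0 - u 0 1 * v 1 0 - u 1 0 * v 0 1

lemma contr_eq_contrC (u v : Fin 4 → ℂ) :
    contr u v = contrC (fun A A' => ∑ r, solder A A' r * u r)
      (fun A A' => ∑ r, solder A A' r * v r) := by
  simp [contr, contrC, solder, Fin.sum_univ_four]
  linear_combination (-2 * u 3 * v 3) * Complex.I_sq

lemma sum_mul_contr_left (c : Fin 4 → ℂ) (U : Fin 4 → Fin 4 → ℂ) (v : Fin 4 → ℂ) :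
    ∑ i, c i * contr (U i) v = contr (fun r => ∑ i, c i * U i r) v := by
  simp only [contr, Fin.sum_univ_four]
  ring

lemma sum_mul_contr_right (c : Fin 4 → ℂ) (u : Fin 4 → ℂ) (V : Fin 4 → Fin 4 → ℂ) :
    ∑ i, c i * contr u (V i) = contr u (fun r => ∑ i, c i * V i r) := by
  simp only [contr, Fin.sum_univ_four]
  ring

lemma sum_contr_sum (a b c d : Fin 4 → ℂ) (G H : Fin 4 → Fin 4 → Fin 4 → ℂ) :
    ∑ p, ∑ q, ∑ s, ∑ t, a p * b q * c s * d t * contr (G p q) (H s t)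
      = contr (fun r => ∑ p, ∑ q, a p * b q * G p q r)
          (fun r => ∑ s, ∑ t, c s * d t * H s t r) := by
  simp only [mul_assoc, ← Finset.mul_sum, sum_mul_contr_left, sum_mul_contr_right]

lemma sum_pair_comm {ι : Type*} [Fintype ι] (F : ι → ι → ι → ι → ℂ) :
    ∑ i, ∑ j, ∑ k, ∑ m, F i j k m = ∑ k, ∑ m, ∑ i, ∑ j, F i j k m := by
  calc ∑ i, ∑ j, ∑ k, ∑ m, F i j k m = ∑ i, ∑ k, ∑ m, ∑ j, F i j k m :=
        Finset.sum_congr rfl fun i _ => Finset.sum_comm.trans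
          (Finset.sum_congr rfl fun k _ => Finset.sum_comm)
    _ = ∑ k, ∑ m, ∑ i, ∑ j, F i j k m :=
        Finset.sum_comm.trans (Finset.sum_congr rfl fun k _ => Finset.sum_comm)

lemma contr_ofReal (u v : Fin 4 → ℝ) :
    ((contr u v : ℝ) : ℂ) = contr (fun r => (u r : ℂ)) (fun r => (v r : ℂ)) := by
  simp [contr]

lemma SmoothScalar.mdifferentiableAt {f : M → ℂ} (hf : SmoothScalar f) (x : M) :
    MDifferentiableAt 𝓘(ℝ, E4) 𝓘(ℝ, ℂ) f x := (hf x).mdifferentiableAt (by simp)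

lemma SmoothScalar.add {f h : M → ℂ} (hf : SmoothScalar f) (hh : SmoothScalar h) :
    SmoothScalar (fun x => f x + h x) := ContMDiff.add hf hh

lemma SmoothScalar.mul {f h : M → ℂ} (hf : SmoothScalar f) (hh : SmoothScalar h) :
    SmoothScalar (fun x => f x * h x) :=
  contDiff_mul.contMDiff.comp (hf.prodMk_space hh)

lemma SmoothScalar.const_mul (c : ℂ) {f : M → ℂ} (hf : SmoothScalar f) :
    SmoothScalar (fun x => c * f x) :=
  SmoothScalar.mul contMDiff_const hf

lemma SmoothScalar.sum {ι : Type*} {s : Finset ι} {f : ι → M → ℂ} (hf : ∀ i, SmoothScalar (f i)) :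
    SmoothScalar (fun x => ∑ i ∈ s, f i x) := contMDiff_finsetSum fun i _ => hf i

namespace SpinDyad

variable [IsManifold 𝓘(ℝ, E4) ∞ M] {g : LorentzianMetric M} (D : SpinDyad g)

lemma der_smooth (i : Fin 4) {f : M → ℂ} (hf : SmoothScalar f) : SmoothScalar (D.der i f) :=
  contMDiff_mvfderiv_apply hf (D.smooth_frame i)

lemma der_sum {ι : Type*} {s : Finset ι} {f : ι → M → ℂ} (hf : ∀ i, SmoothScalar (f i))
    (p : Fin 4) (x : M) : D.der p (fun y => ∑ i ∈ s, f i y) x = ∑ i ∈ s, D.der p (f i) x :=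
  mvfderiv_finsetSum s (fun i => (hf i).mdifferentiableAt x) _

lemma der_const_mul (c : ℂ) {f : M → ℂ} (hf : SmoothScalar f) (p : Fin 4) (x : M) :
    D.der p (fun y => c * f y) x = c * D.der p f x := by
  simpa [der] using
    mvfderiv_clm_comp (c • ContinuousLinearMap.id ℝ ℂ) (hf.mdifferentiableAt x) (D.frame p x)

lemma dir_eq (A A' : Fin 2) (f : M → ℂ) (x : M) :
    D.dir A A' f x = ∑ i, solder A A' i * D.der i f x := rfl

lemma dir_smooth (A A' : Fin 2) {f : M → ℂ} (hf : SmoothScalar f) : SmoothScalar (D.dir A A' f) :=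
  SmoothScalar.sum fun i => (D.der_smooth i hf).const_mul _

lemma dir_const (A A' : Fin 2) (c : ℂ) (x : M) : D.dir A A' (fun _ => c) x = 0 := by
  simp [dir, mvfderiv_const]

lemma dir_sum {ι : Type*} {s : Finset ι} {f : ι → M → ℂ} (hf : ∀ i, SmoothScalar (f i))
    (A A' : Fin 2) (x : M) :
    D.dir A A' (fun y => ∑ i ∈ s, f i y) x = ∑ i ∈ s, D.dir A A' (f i) x := by
  simp only [dir_eq, D.der_sum hf, Finset.mul_sum]
  rw [Finset.sum_comm]

lemma dir_const_mul (c : ℂ) {f : M → ℂ} (hf : SmoothScalar f) (A A' : Fin 2) (x : M) :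
    D.dir A A' (fun y => c * f y) x = c * D.dir A A' f x := by
  simp only [dir_eq, D.der_const_mul c hf, Finset.mul_sum]
  exact Finset.sum_congr rfl fun _ _ => by ring

lemma dir_add {f h : M → ℂ} (hf : SmoothScalar f) (hh : SmoothScalar h) (A A' : Fin 2) (x : M) :
    D.dir A A' (fun y => f y + h y) x = D.dir A A' f x + D.dir A A' h x := by
  simp only [dir, mvfderiv_fun_add (hf.mdifferentiableAt x) (hh.mdifferentiableAt x),
    add_apply, mul_add, Finset.sum_add_distrib]

lemma dir_mul {f h : M → ℂ} (hf : SmoothScalar f) (hh : SmoothScalar h) (A A' : Fin 2) (x : M) :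
    D.dir A A' (fun y => f y * h y) x = f x * D.dir A A' h x + D.dir A A' f x * h x := by
  simp only [dir, mvfderiv_complex_mul (hf.mdifferentiableAt x) (hh.mdifferentiableAt x),
    Finset.mul_sum, Finset.sum_mul, ← Finset.sum_add_distrib]
  exact Finset.sum_congr rfl fun _ _ => by ring

lemma smooth_ofReal_Gam (i j k : Fin 4) : SmoothScalar (fun x => (D.Gam i j k x : ℂ)) :=
  Complex.ofRealCLM.contMDiff.comp (D.contMDiff_Gam i j k)

lemma der_ofReal_Gam (p i j k : Fin 4) (x : M) :
    D.der p (fun y => (D.Gam i j k y : ℂ)) x = ((D.der p (D.Gam i j k) x : ℝ) : ℂ) :=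
  mvfderiv_clm_comp Complex.ofRealCLM ((D.contMDiff_Gam i j k x).mdifferentiableAt (by simp)) _

lemma smooth_GamC (A A' B B' C C' : Fin 2) : SmoothScalar (D.GamC A A' B B' C C') :=
  SmoothScalar.sum fun i => SmoothScalar.sum fun j => SmoothScalar.sum fun k =>
    (D.smooth_ofReal_Gam i j k).const_mul _

lemma dir_GamC (P P' A A' B B' C C' : Fin 2) (x : M) :
    D.dir P P' (D.GamC A A' B B' C C') x
      = ∑ p, ∑ i, ∑ j, ∑ k, solder P P' p * solder A A' i * solder B B' j * solder C C' k
        * ((D.der p (D.Gam i j k) x : ℝ) : ℂ) := by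
  have h : ∀ p, D.der p (D.GamC A A' B B' C C') x
      = ∑ i, ∑ j, ∑ k, solder A A' i * solder B B' j * solder C C' k
        * ((D.der p (D.Gam i j k) x : ℝ) : ℂ) := by
    intro p
    unfold GamC
    rw [D.der_sum fun i => SmoothScalar.sum fun j => SmoothScalar.sum fun k =>
      (D.smooth_ofReal_Gam i j k).const_mul _]
    refine Finset.sum_congr rfl fun i _ => ?_
    rw [D.der_sum fun j => SmoothScalar.sum fun k => (D.smooth_ofReal_Gam i j k).const_mul _]
    refine Finset.sum_congr rfl fun j _ => ?_
    rw [D.der_sum fun k => (D.smooth_ofReal_Gam i j k).const_mul _]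
    refine Finset.sum_congr rfl fun k _ => ?_
    rw [D.der_const_mul _ (D.smooth_ofReal_Gam i j k), der_ofReal_Gam]
  simp only [dir_eq, h, Finset.mul_sum, mul_assoc]

lemma sum_solder_Gam (A A' B B' C C' : Fin 2) (x : M) :
    ∑ r, solder C C' r * ∑ i, ∑ j, solder A A' i * solder B B' j * (D.Gam i j r x : ℂ)
      = D.GamC A A' B B' C C' x := by
  simp only [GamC, Finset.mul_sum]
  rw [Finset.sum_comm]
  refine Finset.sum_congr rfl fun i _ => ?_
  rw [Finset.sum_comm]
  exact Finset.sum_congr rfl fun j _ => Finset.sum_congr rfl fun k _ => by ring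

/-- The Riemann tensor in terms of the connection coefficients, in the null tetrad. -/
lemma riemC_eq (A A' B B' C C' E E' : Fin 2) (x : M) :
    D.riemC A A' B B' C C' E E' x
      = D.dir A A' (D.GamC B B' C C' E E') x - D.dir B B' (D.GamC A A' C C' E E') x
      - contrC (fun P P' => D.GamC B B' C C' P P' x) (fun P P' => D.GamC A A' E E' P P' x)
      + contrC (fun P P' => D.GamC A A' C C' P P' x) (fun P P' => D.GamC B B' E E' P P' x)
      - contrC (fun P P' => D.GamC A A' B B' P P' x - D.GamC B B' A A' P P' x)
          (fun P P' => D.GamC P P' C C' E E' x) := by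
  have quad : ∀ X X' Y Y' U U' V V' : Fin 2,
      ∑ p, ∑ q, ∑ s, ∑ t, solder X X' p * solder Y Y' q * solder U U' s * solder V V' t
        * contr (fun r => (D.Gam p q r x : ℂ)) (fun r => (D.Gam s t r x : ℂ))
      = contrC (fun P P' => D.GamC X X' Y Y' P P' x) (fun P P' => D.GamC U U' V V' P P' x) := by
    intro X X' Y Y' U U' V V'
    rw [sum_contr_sum, contr_eq_contrC]
    simp only [sum_solder_Gam]
  have t2 : ∑ i, ∑ j, ∑ k, ∑ m, solder A A' i * solder B B' j * solder C C' k * solder E E' m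
        * ((D.der j (D.Gam i k m) x : ℝ) : ℂ) = D.dir B B' (D.GamC A A' C C' E E') x := by
    rw [dir_GamC, Finset.sum_comm]
    simp only [mul_comm (solder A A' _) (solder B B' _)]
  have t3 : ∑ i, ∑ j, ∑ k, ∑ m, solder A A' i * solder B B' j * solder C C' k * solder E E' m
        * contr (fun r => (D.Gam j k r x : ℂ)) (fun r => (D.Gam i m r x : ℂ))
      = contrC (fun P P' => D.GamC B B' C C' P P' x) (fun P P' => D.GamC A A' E E' P P' x) := by
    rw [← quad, Finset.sum_comm]
    refine Finset.sum_congr rfl fun j _ => ?_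
    rw [Finset.sum_comm]
    refine Finset.sum_congr rfl fun k _ => Finset.sum_congr rfl fun i _ =>
      Finset.sum_congr rfl fun m _ => by ring
  have t4 : ∑ i, ∑ j, ∑ k, ∑ m, solder A A' i * solder B B' j * solder C C' k * solder E E' m
        * contr (fun r => (D.Gam i k r x : ℂ)) (fun r => (D.Gam j m r x : ℂ))
      = contrC (fun P P' => D.GamC A A' C C' P P' x) (fun P P' => D.GamC B B' E E' P P' x) := by
    rw [← quad]
    refine Finset.sum_congr rfl fun i _ => ?_
    rw [Finset.sum_comm]
    refine Finset.sum_congr rfl fun k _ => Finset.sum_congr rfl fun j _ =>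
      Finset.sum_congr rfl fun m _ => by ring
  have t5 : ∑ i, ∑ j, ∑ k, ∑ m, solder A A' i * solder B B' j * solder C C' k * solder E E' m
        * contr (fun r => (D.Gam i j r x : ℂ) - (D.Gam j i r x : ℂ)) (fun r => (D.Gam r k m x : ℂ))
      = contrC (fun P P' => D.GamC A A' B B' P P' x - D.GamC B B' A A' P P' x)
          (fun P P' => D.GamC P P' C C' E E' x) := by
    rw [sum_contr_sum (G := fun i j r => (D.Gam i j r x : ℂ) - (D.Gam j i r x : ℂ))
      (H := fun k m r => (D.Gam r k m x : ℂ)), contr_eq_contrC]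
    congr 1
    · funext P P'
      rw [← sum_solder_Gam, ← sum_solder_Gam, ← Finset.sum_sub_distrib]
      refine Finset.sum_congr rfl fun r _ => ?_
      rw [← mul_sub]
      congr 1
      rw [Finset.sum_comm (f := fun i j => solder B B' i * solder A A' j * (D.Gam i j r x : ℂ)),
        ← Finset.sum_sub_distrib]
      refine Finset.sum_congr rfl fun i _ => ?_
      rw [← Finset.sum_sub_distrib]
      exact Finset.sum_congr rfl fun j _ => by ring
    · funext P P'
      simp only [GamC, Finset.mul_sum, mul_assoc]
  rw [dir_GamC, ← t2, ← t3, ← t4, ← t5]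
  simp only [riemC, riem_eq, ← Finset.sum_sub_distrib, ← Finset.sum_add_distrib]
  refine Finset.sum_congr rfl fun i _ => Finset.sum_congr rfl fun j _ =>
    Finset.sum_congr rfl fun k _ => Finset.sum_congr rfl fun m _ => ?_
  push_cast [contr_ofReal]
  ring

/-- Commutator of the tetrad derivatives. -/
lemma dir_comm {f : M → ℂ} (hf : SmoothScalar f) (A A' B B' : Fin 2) (x : M) :
    D.dir A A' (D.dir B B' f) x - D.dir B B' (D.dir A A' f) x
      = contrC (fun P P' => D.GamC A A' B B' P P' x - D.GamC B B' A A' P P' x)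
          (fun P P' => D.dir P P' f x) := by
  have h : ∀ X X' Y Y' : Fin 2, D.dir X X' (D.dir Y Y' f) x
      = ∑ i, ∑ j, solder X X' i * solder Y Y' j * D.der i (D.der j f) x := by
    intro X X' Y Y'
    have h' : D.dir Y Y' f = fun y => ∑ j, solder Y Y' j * D.der j f y := rfl
    rw [h', D.dir_sum fun j => (D.der_smooth j hf).const_mul _]
    simp only [D.dir_const_mul _ (D.der_smooth _ hf), dir_eq, Finset.mul_sum]
    rw [Finset.sum_comm]
    exact Finset.sum_congr rfl fun i _ => Finset.sum_congr rfl fun j _ => by ring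
  rw [h, h, Finset.sum_comm (f := fun i j => solder B B' i * solder A A' j
    * D.der i (D.der j f) x), ← Finset.sum_sub_distrib]
  have h2 : ∀ i j, solder A A' i * solder B B' j * D.der i (D.der j f) x
      - solder B B' j * solder A A' i * D.der j (D.der i f) x
      = solder A A' i * (solder B B' j * contr (fun r => (D.Gam i j r x : ℂ) - (D.Gam j i r x : ℂ))
          (fun r => D.der r f x)) := by
    intro i j
    have := D.der_comm hf i j x
    push_cast at this
    rw [← this]
    ring
  simp only [← Finset.sum_sub_distrib, h2, ← Finset.mul_sum, sum_mul_contr_left]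
  rw [contr_eq_contrC]
  congr 1
  funext P P'
  rw [← sum_solder_Gam, ← sum_solder_Gam, ← Finset.sum_sub_distrib]
  refine Finset.sum_congr rfl fun r _ => ?_
  rw [← mul_sub]
  congr 1
  rw [Finset.sum_comm (f := fun i j => solder B B' i * solder A A' j * (D.Gam i j r x : ℂ)),
    ← Finset.sum_sub_distrib]
  refine Finset.sum_congr rfl fun i _ => ?_
  rw [← Finset.sum_sub_distrib, Finset.mul_sum]
  exact Finset.sum_congr rfl fun j _ => by ring

lemma GamC_antisymm (A A' B B' C C' : Fin 2) (x : M) :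
    D.GamC A A' B B' C C' x = - D.GamC A A' C C' B B' x := by
  simp only [GamC, ← Finset.sum_neg_distrib]
  refine Finset.sum_congr rfl fun i _ => ?_
  rw [Finset.sum_comm]
  refine Finset.sum_congr rfl fun j _ => Finset.sum_congr rfl fun k _ => ?_
  rw [D.Gam_antisymm i k j]
  push_cast
  ring

lemma riemC_pair_symm (A A' B B' C C' E E' : Fin 2) (x : M) :
    D.riemC A A' B B' C C' E E' x = D.riemC C C' E E' A A' B B' x := by
  have h : ∀ i j k m : Fin 4, solder A A' i * solder B B' j * solder C C' k * solder E E' m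
      * (D.riem i j k m x : ℂ) = solder C C' k * solder E E' m * solder A A' i * solder B B' j
      * (D.riem k m i j x : ℂ) := fun i j k m => by rw [D.riem_pair_symm i j k m]; ring
  simp only [riemC, h]
  exact sum_pair_comm _

lemma riemC_antisymm_left (A A' B B' C C' E E' : Fin 2) (x : M) :
    D.riemC A A' B B' C C' E E' x = - D.riemC B B' A A' C C' E E' x := by
  simp only [riemC_eq, contrC]
  ring

lemma eps_antisymm (A B : Fin 2) : eps A B = - eps B A := by
  fin_cases A <;> fin_cases B <;> simp [eps]

lemma curvX_pair_symm (A B C E : Fin 2) (x : M) : D.curvX A B C E x = D.curvX C E A B x := by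
  unfold curvX
  rw [sum_pair_comm]
  refine congrArg ((1 / 4 : ℂ) * ·) ?_
  refine Finset.sum_congr rfl fun A' _ => Finset.sum_congr rfl fun B' _ =>
    Finset.sum_congr rfl fun C' _ => Finset.sum_congr rfl fun E' _ => ?_
  rw [riemC_pair_symm]
  ring

lemma curvX_symm_left (A B C E : Fin 2) (x : M) : D.curvX A B C E x = D.curvX B A C E x := by
  unfold curvX
  rw [Finset.sum_comm]
  refine congrArg ((1 / 4 : ℂ) * ·) ?_
  refine Finset.sum_congr rfl fun A' _ => Finset.sum_congr rfl fun B' _ =>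
    Finset.sum_congr rfl fun C' _ => Finset.sum_congr rfl fun E' _ => ?_
  rw [riemC_antisymm_left, eps_antisymm B' A']
  ring

end SpinDyad

end Spacetime

end

noncomputable section

namespace Spacetime

variable {M : Type*} [TopologicalSpace M] [ChartedSpace E4 M]

namespace SpinDyad

variable [IsManifold 𝓘(ℝ, E4) ∞ M] {g : LorentzianMetric M} (D : SpinDyad g)

/-- The coefficients `½ ε^{BC} g(∇_{AA'} e_{BB'}, e_{CC'})` of the connection on primed spinors. -/
def spinGamBar (A A' B' C' : Fin 2) (x : M) : ℂ :=
  (1 / 2) * ∑ B, ∑ C, eps B C * D.GamC A A' B B' C C' x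

lemma eps_zero_zero : eps 0 0 = 0 := rfl
lemma eps_zero_one : eps 0 1 = 1 := rfl
lemma eps_one_zero : eps 1 0 = -1 := rfl
lemma eps_one_one : eps 1 1 = 0 := rfl

lemma smooth_spinGam (A A' B C : Fin 2) : SmoothScalar (D.spinGam A A' B C) :=
  SmoothScalar.const_mul _ <| SmoothScalar.sum fun B' => SmoothScalar.sum fun C' =>
    (D.smooth_GamC A A' B B' C C').const_mul _

lemma smooth_spinGamBar (A A' B' C' : Fin 2) : SmoothScalar (D.spinGamBar A A' B' C') :=
  SmoothScalar.const_mul _ <| SmoothScalar.sum fun B => SmoothScalar.sum fun C =>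
    (D.smooth_GamC A A' B B' C C').const_mul _

lemma GamC_self (A A' B B' : Fin 2) (x : M) : D.GamC A A' B B' B B' x = 0 :=
  self_eq_neg.1 (D.GamC_antisymm A A' B B' B B' x)

lemma spinGam_symm (A A' B C : Fin 2) (x : M) : D.spinGam A A' B C x = D.spinGam A A' C B x := by
  simp only [spinGam, Fin.sum_univ_two, eps_zero_zero, eps_zero_one, eps_one_zero, eps_one_one]
  rw [D.GamC_antisymm A A' B 0 C 1, D.GamC_antisymm A A' B 1 C 0]
  ring

lemma spinGamBar_symm (A A' B' C' : Fin 2) (x : M) :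
    D.spinGamBar A A' B' C' x = D.spinGamBar A A' C' B' x := by
  simp only [spinGamBar, Fin.sum_univ_two, eps_zero_zero, eps_zero_one, eps_one_zero, eps_one_one]
  rw [D.GamC_antisymm A A' 0 B' 1 C', D.GamC_antisymm A A' 1 B' 0 C']
  ring

/-- The decomposition of the connection into its unprimed and primed spinor parts. -/
lemma GamC_decomp (A A' B B' C C' : Fin 2) (x : M) :
    D.GamC A A' B B' C C' x
      = eps B' C' * D.spinGam A A' B C x + eps B C * D.spinGamBar A A' B' C' x := by
  simp only [spinGam, spinGamBar, Fin.sum_univ_two, eps_zero_zero, eps_zero_one, eps_one_zero,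
    eps_one_one]
  have h := fun P P' Q Q' => D.GamC_antisymm A A' P P' Q Q' x
  fin_cases B <;> fin_cases B' <;> fin_cases C <;> fin_cases C' <;>
    simp [eps_zero_zero, eps_zero_one, eps_one_zero, eps_one_one, GamC_self, h 0 1 0 0,
      h 1 0 0 0, h 1 1 0 0, h 1 0 0 1, h 1 1 0 1, h 1 1 1 0] <;> ring

lemma dir_GamC_decomp (P P' A A' B B' C C' : Fin 2) (x : M) :
    D.dir P P' (D.GamC A A' B B' C C') x
      = eps B' C' * D.dir P P' (D.spinGam A A' B C) x
        + eps B C * D.dir P P' (D.spinGamBar A A' B' C') x := by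
  have h : D.GamC A A' B B' C C' = fun y =>
      eps B' C' * D.spinGam A A' B C y + eps B C * D.spinGamBar A A' B' C' y :=
    funext fun y => D.GamC_decomp A A' B B' C C' y
  have hg := D.smooth_spinGam A A' B C
  have hb := D.smooth_spinGamBar A A' B' C'
  rw [h, D.dir_add (hg.const_mul _) (hb.const_mul _), D.dir_const_mul _ hg, D.dir_const_mul _ hb]

lemma dir_spinGamBar_symm (P P' A A' B C : Fin 2) (x : M) :
    D.dir P P' (D.spinGamBar A A' B C) x = D.dir P P' (D.spinGamBar A A' C B) x := by
  have h : D.spinGamBar A A' B C = D.spinGamBar A A' C B :=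
    funext fun y => D.spinGamBar_symm A A' B C y
  rw [h]

/-- The components of the covariant derivatives that make up the projected Killing spinor
equation. -/
lemma isProjKillingSpinor_iff (hSFR : ∀ A' x, D.spinGam 0 A' 0 0 x = 0) (K0 K1 K2 : M → ℂ) :
    D.IsProjKillingSpinor (spinorK K0 K1 K2) ↔
      (∀ A' x, D.dir 0 A' K0 x = 2 * D.spinGam 0 A' 0 1 x * K0 x) ∧
      (∀ A' x, D.dir 0 A' K1 x = D.spinGam 0 A' 1 1 x * K0 x + D.spinGam 1 A' 0 1 x * K0 x
        + (-1 / 2) * D.dir 1 A' K0 x + (-1) * (D.spinGam 1 A' 0 0 x * K1 x)) ∧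
      (∀ A' x, 2 * (D.dir 1 A' K1 x - D.spinGam 1 A' 1 1 x * K0 x + D.spinGam 1 A' 0 0 x * K2 x)
        + (D.dir 0 A' K2 x - 2 * D.spinGam 0 A' 1 1 x * K1 x
          + 2 * D.spinGam 0 A' 0 1 x * K2 x) = 0) := by
  have e00 : spinorK K0 K1 K2 0 0 = K0 := by
    funext x; simp [spinorK, lower, o, iota, eps]
  have e01 : spinorK K0 K1 K2 0 1 = K1 := by
    funext x; simp [spinorK, lower, o, iota, eps]
  have e10 : spinorK K0 K1 K2 1 0 = K1 := by
    funext x; simp [spinorK, lower, o, iota, eps]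
  have e11 : spinorK K0 K1 K2 1 1 = K2 := by
    funext x; simp [spinorK, lower, o, iota, eps]
  have s10 := fun A A' x => D.spinGam_symm A A' 1 0 x
  have hall : ∀ A' B C x, ∑ A, o A * ((1 / 3) *
      (D.nabla2 A A' (spinorK K0 K1 K2) B C x + D.nabla2 B A' (spinorK K0 K1 K2) C A x
        + D.nabla2 C A' (spinorK K0 K1 K2) A B x))
      = (1 / 3) * (D.nabla2 0 A' (spinorK K0 K1 K2) B C x
        + D.nabla2 B A' (spinorK K0 K1 K2) C 0 x + D.nabla2 C A' (spinorK K0 K1 K2) 0 B x) := by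
    intro A' B C x
    simp [Fin.sum_univ_two, o]
  simp only [IsProjKillingSpinor, hall]
  have c00 : ∀ A' x, (1 / 3) * (D.nabla2 0 A' (spinorK K0 K1 K2) 0 0 x
        + D.nabla2 0 A' (spinorK K0 K1 K2) 0 0 x + D.nabla2 0 A' (spinorK K0 K1 K2) 0 0 x)
      = D.dir 0 A' K0 x - 2 * D.spinGam 0 A' 0 1 x * K0 x := by
    intro A' x
    simp only [nabla2, spinGamUp, Fin.sum_univ_two, e00, e01, e10, eps_zero_zero,
      eps_zero_one, eps_one_zero, eps_one_one, hSFR]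
    ring
  have c01 : ∀ A' x, (1 / 3) * (D.nabla2 0 A' (spinorK K0 K1 K2) 0 1 x
        + D.nabla2 0 A' (spinorK K0 K1 K2) 1 0 x + D.nabla2 1 A' (spinorK K0 K1 K2) 0 0 x)
      = (2 / 3) * (D.dir 0 A' K1 x - (D.spinGam 0 A' 1 1 x * K0 x + D.spinGam 1 A' 0 1 x * K0 x
        + (-1 / 2) * D.dir 1 A' K0 x + (-1) * (D.spinGam 1 A' 0 0 x * K1 x))) := by
    intro A' x
    simp only [nabla2, spinGamUp, Fin.sum_univ_two, e00, e01, e10, e11, s10, eps_zero_zero,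
      eps_zero_one, eps_one_zero, eps_one_one, hSFR]
    ring
  have c10 : ∀ A' x, (1 / 3) * (D.nabla2 0 A' (spinorK K0 K1 K2) 1 0 x
        + D.nabla2 1 A' (spinorK K0 K1 K2) 0 0 x + D.nabla2 0 A' (spinorK K0 K1 K2) 0 1 x)
      = (2 / 3) * (D.dir 0 A' K1 x - (D.spinGam 0 A' 1 1 x * K0 x + D.spinGam 1 A' 0 1 x * K0 x
        + (-1 / 2) * D.dir 1 A' K0 x + (-1) * (D.spinGam 1 A' 0 0 x * K1 x))) := by
    intro A' x
    rw [← c01]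
    ring
  have c11 : ∀ A' x, (1 / 3) * (D.nabla2 0 A' (spinorK K0 K1 K2) 1 1 x
        + D.nabla2 1 A' (spinorK K0 K1 K2) 1 0 x + D.nabla2 1 A' (spinorK K0 K1 K2) 0 1 x)
      = (1 / 3) * (2 * (D.dir 1 A' K1 x - D.spinGam 1 A' 1 1 x * K0 x
          + D.spinGam 1 A' 0 0 x * K2 x)
        + (D.dir 0 A' K2 x - 2 * D.spinGam 0 A' 1 1 x * K1 x
          + 2 * D.spinGam 0 A' 0 1 x * K2 x)) := by
    intro A' x
    simp only [nabla2, spinGamUp, Fin.sum_univ_two, e00, e01, e10, e11, s10, eps_zero_zero,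
      eps_zero_one, eps_one_zero, eps_one_one]
    ring
  constructor
  · intro h
    refine ⟨fun A' x => ?_, fun A' x => ?_, fun A' x => ?_⟩
    · linear_combination h A' 0 0 x - c00 A' x
    · linear_combination (3 / 2) * (h A' 0 1 x - c01 A' x)
    · linear_combination 3 * (h A' 1 1 x - c11 A' x)
  · rintro ⟨h0, h1, h2⟩ A' B C x
    fin_cases B <;> fin_cases C
    · exact (c00 A' x).trans (by rw [h0]; ring)
    · exact (c01 A' x).trans (by rw [h1]; ring)
    · exact (c10 A' x).trans (by rw [h1]; ring)
    · exact (c11 A' x).trans (by rw [h2]; ring)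

/-- The integrability condition of the first two parts of the projected Killing spinor equation
along a shear-free ray. -/
lemma integrability (hSFR : ∀ A' x, D.spinGam 0 A' 0 0 x = 0) {K0 K1 : M → ℂ}
    (hK0 : SmoothScalar K0) (hK1 : SmoothScalar K1)
    (h0 : ∀ A' x, D.dir 0 A' K0 x = 2 * D.spinGam 0 A' 0 1 x * K0 x)
    (h1 : ∀ A' x, D.dir 0 A' K1 x = D.spinGam 0 A' 1 1 x * K0 x + D.spinGam 1 A' 0 1 x * K0 x
        + (-1 / 2) * D.dir 1 A' K0 x + (-1) * (D.spinGam 1 A' 0 0 x * K1 x)) (x : M) :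
    (D.curvX 0 0 1 1 x + 2 * D.curvX 0 1 0 1 x) * K0 x = 2 * D.curvX 0 1 0 0 x * K1 x := by
  have hz : ∀ P P' A', D.dir P P' (D.spinGam 0 A' 0 0) x = 0 := by
    intro P P' A'
    have h : D.spinGam 0 A' 0 0 = fun _ => 0 := funext fun y => hSFR A' y
    rw [h, dir_const]
  have sg := D.smooth_spinGam
  have dd0 : ∀ P P' A', D.dir P P' (D.dir 0 A' K0) x
      = 2 * (D.spinGam 0 A' 0 1 x * D.dir P P' K0 x
        + D.dir P P' (D.spinGam 0 A' 0 1) x * K0 x) := by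
    intro P P' A'
    have h : D.dir 0 A' K0 = fun y => 2 * (D.spinGam 0 A' 0 1 y * K0 y) :=
      funext fun y => (h0 A' y).trans (by ring)
    rw [h, D.dir_const_mul _ ((sg _ _ _ _).mul hK0), D.dir_mul (sg _ _ _ _) hK0]
  have dd1 : ∀ P P' A', D.dir P P' (D.dir 0 A' K1) x
      = (D.spinGam 0 A' 1 1 x * D.dir P P' K0 x + D.dir P P' (D.spinGam 0 A' 1 1) x * K0 x)
        + (D.spinGam 1 A' 0 1 x * D.dir P P' K0 x + D.dir P P' (D.spinGam 1 A' 0 1) x * K0 x)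
        + (-1 / 2) * D.dir P P' (D.dir 1 A' K0) x
        + (-1) * (D.spinGam 1 A' 0 0 x * D.dir P P' K1 x
          + D.dir P P' (D.spinGam 1 A' 0 0) x * K1 x) := by
    intro P P' A'
    have s1 := (sg 0 A' 1 1).mul hK0
    have s2 := (sg 1 A' 0 1).mul hK0
    have s3 := (D.dir_smooth 1 A' hK0).const_mul (-1 / 2)
    have s4 := (sg 1 A' 0 0).mul hK1
    rw [funext (h1 A'), D.dir_add ((s1.add s2).add s3) (s4.const_mul _),
      D.dir_add (s1.add s2) s3, D.dir_add s1 s2, D.dir_const_mul _ s4,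
      D.dir_const_mul _ (D.dir_smooth 1 A' hK0), D.dir_mul (sg _ _ _ _) hK0,
      D.dir_mul (sg _ _ _ _) hK0, D.dir_mul (sg _ _ _ _) hK1]
  have c1 := D.dir_comm hK1 0 0 0 1 x
  have c2 := D.dir_comm hK0 0 0 1 1 x
  have c3 := D.dir_comm hK0 0 1 1 0 x
  simp only [curvX, Fin.sum_univ_two, riemC_eq, contrC, GamC_decomp, dir_GamC_decomp, dd0, dd1,
    h0, h1, hSFR, hz, eps_zero_zero, eps_zero_one, eps_one_zero, eps_one_one, zero_mul, mul_zero,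
    zero_add, add_zero, fun A A' x => D.spinGam_symm A A' 1 0 x,
    fun A A' x => D.spinGamBar_symm A A' 1 0 x,
    fun P P' A A' x => D.dir_spinGamBar_symm P P' A A' 1 0 x] at c1 c2 c3 ⊢
  linear_combination c1 + (1 / 2) * c2 - (1 / 2) * c3

lemma spinGam_eq_zero_of_isShearFreeRay (h : D.IsShearFreeRay) (A' : Fin 2) (x : M) :
    D.spinGam 0 A' 0 0 x = 0 := by
  have := h A' x
  simpa [Fin.sum_univ_two, o, nabla1, lower, eps, spinGamUp, dir_const] using this

/-- Along a shear-free ray which is a repeated principal spinor, `K₀ = 0` wherever `Ψ₂ ≠ 0`. -/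
lemma eq_zero_of_integrability (hRPS : D.IsRepeatedPrincipal) {K0 K1 : ℂ} {x : M}
    (hPsi2 : D.psi2 x ≠ 0)
    (h : (D.curvX 0 0 1 1 x + 2 * D.curvX 0 1 0 1 x) * K0 = 2 * D.curvX 0 1 0 0 x * K1) :
    K0 = 0 := by
  have h1 := hRPS 1 x
  simp only [Fin.sum_univ_two, o, weyl, Matrix.cons_val_zero, Matrix.cons_val_one, mul_one,
    mul_zero, add_zero, D.curvX_symm_left 1 0, D.curvX_pair_symm 0 0 1 0] at h1
  have h2 : D.psi2 x = (D.curvX 0 0 1 1 x + 2 * D.curvX 0 1 0 1 x) / 3 := by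
    simp only [psi2, Fin.sum_univ_two, o, iota, weyl, Matrix.cons_val_zero, Matrix.cons_val_one,
      mul_one, mul_zero, add_zero, zero_add, D.curvX_pair_symm 1 1 0 0]
    ring
  have h3 : D.psi2 x * K0 = 0 := by
    rw [h2]
    linear_combination (1 / 3) * h + (2 / 3) * K1 * h1
  exact (mul_eq_zero.1 h3).resolve_left hPsi2

lemma coeff_eq (α ξ ζ β : Fin 2 → ℂ) (x : M) :
    D.coeff α ξ ζ β x = ∑ A, ∑ A', ∑ B, ξ A * ζ A' * α B *
      (D.spinGam A A' B 0 x * lower β 1 - D.spinGam A A' B 1 x * lower β 0) := by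
  simp only [coeff, nabla1, dir_const, spinGamUp, Fin.sum_univ_two, eps_zero_zero, eps_zero_one,
    eps_one_zero, eps_one_one]
  refine congrArg₂ _ ?_ ?_ <;> ring

lemma rho_eq (x : M) : D.rho x = D.spinGam 1 0 0 0 x := by
  simp [rho, coeff_eq, Fin.sum_univ_two, o, iota, conj, lower, eps]

lemma tau_eq (x : M) : D.tau x = D.spinGam 1 1 0 0 x := by
  simp [tau, coeff_eq, Fin.sum_univ_two, o, iota, conj, lower, eps]

lemma rho'_eq (x : M) : D.rho' x = - D.spinGam 0 1 1 1 x := by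
  simp [rho', coeff_eq, Fin.sum_univ_two, o, iota, conj, lower, eps]

lemma tau'_eq (x : M) : D.tau' x = - D.spinGam 0 0 1 1 x := by
  simp [tau', coeff_eq, Fin.sum_univ_two, o, iota, conj, lower, eps]

lemma epsilon_eq (x : M) : D.epsilon x = D.spinGam 0 0 0 1 x := by
  simp [epsilon, coeff_eq, Fin.sum_univ_two, o, iota, conj, lower, eps, D.spinGam_symm 0 0 1 0]

lemma beta_eq (x : M) : D.beta x = D.spinGam 0 1 0 1 x := by
  simp [beta, coeff_eq, Fin.sum_univ_two, o, iota, conj, lower, eps, D.spinGam_symm 0 1 1 0]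

/-- The four component equations, along a shear-free ray, when `K₀ = 0`. -/
lemma isProjKillingSpinor_zero_iff (hSFR : D.IsShearFreeRay) (K1 K2 : M → ℂ) :
    D.IsProjKillingSpinor (spinorK 0 K1 K2) ↔
      (∀ x, D.edt 0 0 K1 x + D.tau x * K1 x = 0) ∧
      (∀ x, D.tho 0 0 K1 x + D.rho x * K1 x = 0) ∧
      (∀ x, 2 * (D.tho' 0 0 K1 x + D.rho' x * K1 x)
        + (D.edt (-2) 0 K2 x + 2 * D.tau x * K2 x) = 0) ∧
      (∀ x, 2 * (D.edt' 0 0 K1 x + D.tau' x * K1 x)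
        + (D.tho (-2) 0 K2 x + 2 * D.rho x * K2 x) = 0) := by
  have hd : ∀ A A' x, D.dir A A' (0 : M → ℂ) x = 0 := fun A A' x => D.dir_const A A' 0 x
  rw [D.isProjKillingSpinor_iff (D.spinGam_eq_zero_of_isShearFreeRay hSFR)]
  simp only [hd, Fin.forall_fin_two, edt, tho, edt', tho', tau_eq, rho_eq, tau'_eq, rho'_eq,
    epsilon_eq, beta_eq, Pi.zero_apply, Int.cast_zero, Int.cast_neg, Int.cast_ofNat]
  constructor
  · rintro ⟨-, ⟨h1, h2⟩, h3, h4⟩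
    refine ⟨fun x => ?_, fun x => ?_, fun x => ?_, fun x => ?_⟩
    · linear_combination h2 x
    · linear_combination h1 x
    · linear_combination h4 x
    · linear_combination h3 x
  · rintro ⟨h1, h2, h3, h4⟩
    refine ⟨⟨fun x => ?_, fun x => ?_⟩, ⟨fun x => ?_, fun x => ?_⟩, fun x => ?_, fun x => ?_⟩
    · ring
    · ring
    · linear_combination h2 x
    · linear_combination h1 x
    · linear_combination h4 x
    · linear_combination h3 x

/-- `C̃_{A'} K₁` in GHP notation. -/
lemma confTilde_K1_eq_zero_iff (K1 : M → ℂ) :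
    (∀ A' x, D.confTilde 0 1 K1 A' x = 0) ↔
      (∀ x, D.edt 0 0 K1 x + D.tau x * K1 x = 0) ∧
      (∀ x, D.tho 0 0 K1 x + D.rho x * K1 x = 0) := by
  simp only [Fin.forall_fin_two, confTilde, confC, formF, covec, Fin.sum_univ_two, edt, tho]
  simp [o, iota, lower, conj, eps, and_comm]

/-- `C̃_{A'} K₂ + 2 C_{A'} K₁` in GHP notation. -/
lemma confTilde_K2_add_confIota_K1_eq_zero_iff (K1 K2 : M → ℂ) :
    (∀ A' x, D.confTilde (-2) 0 K2 A' x + 2 * D.confIota 0 1 K1 A' x = 0) ↔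
      (∀ x, 2 * (D.tho' 0 0 K1 x + D.rho' x * K1 x)
        + (D.edt (-2) 0 K2 x + 2 * D.tau x * K2 x) = 0) ∧
      (∀ x, 2 * (D.edt' 0 0 K1 x + D.tau' x * K1 x)
        + (D.tho (-2) 0 K2 x + 2 * D.rho x * K2 x) = 0) := by
  have h0 : ∀ x, D.confTilde (-2) 0 K2 0 x + 2 * D.confIota 0 1 K1 0 x
      = 2 * (D.edt' 0 0 K1 x + D.tau' x * K1 x)
        + (D.tho (-2) 0 K2 x + 2 * D.rho x * K2 x) := by
    intro x
    simp [confTilde, confIota, confC, formF, formB, omega, covec, Fin.sum_univ_two, edt', tho,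
      o, iota, lower, conj, eps]
    ring
  have h1 : ∀ x, D.confTilde (-2) 0 K2 1 x + 2 * D.confIota 0 1 K1 1 x
      = 2 * (D.tho' 0 0 K1 x + D.rho' x * K1 x)
        + (D.edt (-2) 0 K2 x + 2 * D.tau x * K2 x) := by
    intro x
    simp [confTilde, confIota, confC, formF, formB, omega, covec, Fin.sum_univ_two, edt, tho',
      o, iota, lower, conj, eps]
    ring
  simp only [Fin.forall_fin_two, h0, h1, and_comm]

end SpinDyad

end Spacetime

end

theorem projKS_iff_components {M : Type*} [TopologicalSpace M] [ChartedSpace Spacetime.E4 M]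
    [IsManifold 𝓘(ℝ, Spacetime.E4) ∞ M]
    (g : Spacetime.LorentzianMetric M) (D : Spacetime.SpinDyad g)
    (hSFR : D.IsShearFreeRay) (hRPS : D.IsRepeatedPrincipal) (hPsi2 : ∀ x, D.psi2 x ≠ 0)
    (K0 K1 K2 : M → ℂ) (hK0 : Spacetime.SmoothScalar K0) (hK1 : Spacetime.SmoothScalar K1)
    (hK2 : Spacetime.SmoothScalar K2) :
    (D.IsProjKillingSpinor (Spacetime.SpinDyad.spinorK K0 K1 K2) ↔
      (K0 = 0 ∧
        (∀ A' x, D.confTilde 0 1 K1 A' x = 0) ∧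
        (∀ A' x, D.confTilde (-2) 0 K2 A' x + 2 * D.confIota 0 1 K1 A' x = 0))) ∧
    (D.IsProjKillingSpinor (Spacetime.SpinDyad.spinorK K0 K1 K2) ↔
      (K0 = 0 ∧
        (∀ x, D.edt 0 0 K1 x + D.tau x * K1 x = 0) ∧
        (∀ x, D.tho 0 0 K1 x + D.rho x * K1 x = 0) ∧
        (∀ x, 2 * (D.tho' 0 0 K1 x + D.rho' x * K1 x)
          + (D.edt (-2) 0 K2 x + 2 * D.tau x * K2 x) = 0) ∧
        (∀ x, 2 * (D.edt' 0 0 K1 x + D.tau' x * K1 x)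
          + (D.tho (-2) 0 K2 x + 2 * D.rho x * K2 x) = 0))) := by
  have hghp : D.IsProjKillingSpinor (Spacetime.SpinDyad.spinorK K0 K1 K2) ↔
      (K0 = 0 ∧
        (∀ x, D.edt 0 0 K1 x + D.tau x * K1 x = 0) ∧
        (∀ x, D.tho 0 0 K1 x + D.rho x * K1 x = 0) ∧
        (∀ x, 2 * (D.tho' 0 0 K1 x + D.rho' x * K1 x)
          + (D.edt (-2) 0 K2 x + 2 * D.tau x * K2 x) = 0) ∧
        (∀ x, 2 * (D.edt' 0 0 K1 x + D.tau' x * K1 x)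
          + (D.tho (-2) 0 K2 x + 2 * D.rho x * K2 x) = 0)) := by
    constructor
    · intro h
      have hs := D.spinGam_eq_zero_of_isShearFreeRay hSFR
      obtain ⟨h0, h1, -⟩ := (D.isProjKillingSpinor_iff hs K0 K1 K2).1 h
      obtain rfl : K0 = 0 := funext fun x =>
        D.eq_zero_of_integrability hRPS (hPsi2 x) (D.integrability hs hK0 hK1 h0 h1 x)
      exact ⟨rfl, (D.isProjKillingSpinor_zero_iff hSFR K1 K2).1 h⟩
    · rintro ⟨rfl, h⟩
      exact (D.isProjKillingSpinor_zero_iff hSFR K1 K2).2 h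
  refine ⟨?_, hghp⟩
  rw [D.confTilde_K1_eq_zero_iff, D.confTilde_K2_add_confIota_K1_eq_zero_iff, and_assoc]
  exact hghp
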